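/- Let p ≥ 1, r₁,…,r_p ≥ 1 and q = r₁+⋯+r_p, and fix real numbers 0 < S⁽¹⁾ < S⁽²⁾ < ⋯ < S⁽ᵖ⁾. Regard ℝ^q as block-decomposed into consecutive blocks of sizes r₁,…,r_p, with block j assigned the height S⁽ʲ⁾, and for h > 0 let Ω(h) be the diagonal matrix whose entries on block j equal e^{−S⁽ʲ⁾/h}. Let N ≥ q and let W(h), h ∈ (0,h₀], be a family of real N×q matrices admitting a classical expansion W(h) ∼ Σ_{k≥0} h^k W_k with W₀ injective, and set 𝓜(h) = Ω(h) W(h)ᵀ W(h) Ω(h). For the symmetric positive definite matrix W₀ᵀW₀ define the iterated Schur complement blocks G_j, 1 ≤ j ≤ p, by: S⁽⁰⁾ = W₀ᵀW₀ and, for 1 ≤ j ≤ p−1, writing S⁽ʲ⁻¹⁾ in block form [[J_j, B_jᵀ],[B_j, N_j]] with J_j its block-(j,j) part, set G_j = J_j and S⁽ʲ⁾ = N_j − B_j J_j⁻¹ B_jᵀ, and G_p = S⁽ᵖ⁻¹⁾. Then there exist c > 0, h₁ ∈ (0,h₀], and for each 1 ≤ j ≤ p and 1 ≤ m ≤ r_j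 a function λ_{j,m} : (0,h₁] → (0,∞) admitting a classical expansion whose leading term is the m-th smallest eigenvalue of G_j (which is positive), such that for all h ∈ (0,h₁] the spectrum of 𝓜(h), counted with multiplicity, consists exactly of q eigenvalues μ_{j,m}(h) satisfying |μ_{j,m}(h) − e^{−2S⁽ʲ⁾/h} λ_{j,m}(h)| ≤ e^{−(2S⁽ʲ⁾+c)/h}. -/

import Mathlib

open Matrix

attribute [local instance] Matrix.normedAddCommGroup

noncomputable section

/-- The index set of `ℝ^q` block-decomposed into `p` consecutive blocks of sizes `r 0, …, r (p-1)`. -/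
abbrev BlockIdx (p : ℕ) (r : Fin p → ℕ) : Type := (j : Fin p) × Fin (r j)

/-- The indices belonging to the blocks `j, j+1, …` (the "tail" starting at block `k`). -/
abbrev TailIdx (p : ℕ) (r : Fin p → ℕ) (k : ℕ) : Type :=
  {i : BlockIdx p r // k ≤ (i.1 : ℕ)}

/-- The indices belonging to block `k`. -/
abbrev BlkIdx (p : ℕ) (r : Fin p → ℕ) (k : ℕ) : Type :=
  {i : BlockIdx p r // (i.1 : ℕ) = k}

/-- One step of Schur complementation: from a matrix on the blocks `k, k+1, …`, written as
`[[J, Bᵀ],[B, N]]` with `J` its block-`(k,k)` part, pass to `N − B J⁻¹ Bᵀ` on the blocks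
`k+1, k+2, …`. -/
def schurStep (p : ℕ) (r : Fin p → ℕ) (k : ℕ)
    (A : Matrix (TailIdx p r k) (TailIdx p r k) ℝ) :
    Matrix (TailIdx p r (k + 1)) (TailIdx p r (k + 1)) ℝ :=
  let e₂ : TailIdx p r (k + 1) → TailIdx p r k := fun i => ⟨i.1, (Nat.le_succ k).trans i.2⟩
  let e₁ : BlkIdx p r k → TailIdx p r k := fun i => ⟨i.1, i.2.ge⟩
  A.submatrix e₂ e₂ - A.submatrix e₂ e₁ * (A.submatrix e₁ e₁)⁻¹ * A.submatrix e₁ e₂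

/-- The iterated Schur complements `S⁽ᵏ⁾` of a block matrix: `S⁽⁰⁾ = M` and `S⁽ᵏ⁺¹⁾` is the
Schur complement of the block-`(k,k)` part of `S⁽ᵏ⁾`. -/
def schurIter (p : ℕ) (r : Fin p → ℕ)
    (M : Matrix (BlockIdx p r) (BlockIdx p r) ℝ) :
    (k : ℕ) → Matrix (TailIdx p r k) (TailIdx p r k) ℝ
  | 0 => M.submatrix (fun i => i.1) (fun i => i.1)
  | k + 1 => schurStep p r k (schurIter p r M k)

/-- `G_k` : the block-`(k,k)` part of the iterated Schur complement `S⁽ᵏ⁾`. -/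
def schurBlock (p : ℕ) (r : Fin p → ℕ)
    (M : Matrix (BlockIdx p r) (BlockIdx p r) ℝ) (k : ℕ) :
    Matrix (BlkIdx p r k) (BlkIdx p r k) ℝ :=
  (schurIter p r M k).submatrix (fun i => ⟨i.1, i.2.ge⟩) (fun i => ⟨i.1, i.2.ge⟩)

section Perturbation

variable {ι : Type*} [Fintype ι] {d : ℕ}

theorem exists_ne_zero_of_vanishing (hd : Fintype.card ι = d)
    (P Q : (ι → ℝ) →ₗ[ℝ] (Fin d → ℝ)) (k : Fin d) :
    ∃ x ≠ 0, (∀ i < k, P x i = 0) ∧ ∀ i, k < i → Q x i = 0 := by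
  classical
  let L : (ι → ℝ) →ₗ[ℝ] ({i : Fin d // i ≠ k} → ℝ) :=
    LinearMap.pi fun i => if i.1 < k then LinearMap.proj i.1 ∘ₗ P else LinearMap.proj i.1 ∘ₗ Q
  have hlt : Module.finrank ℝ ({i : Fin d // i ≠ k} → ℝ) < Module.finrank ℝ (ι → ℝ) := by
    have := k.pos
    simp only [Module.finrank_fintype_fun_eq_card, hd, Fintype.card_subtype_compl,
      Fintype.card_fin, Fintype.card_subtype_eq]
    lia
  obtain ⟨x, hx, hx0⟩ := Submodule.exists_mem_ne_zero_of_ne_bot (L.ker_ne_bot_of_finrank_lt hlt)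
  have hL : ∀ i : {i : Fin d // i ≠ k}, L x i = 0 := fun i => by
    rw [LinearMap.mem_ker.1 hx]; rfl
  refine ⟨x, hx0, fun i hi => ?_, fun i hi => ?_⟩
  · simpa [L, hi] using hL ⟨i, hi.ne⟩
  · simpa [L, hi.not_gt] using hL ⟨i, hi.ne'⟩

/-- Two diagonal quadratic forms with increasing coefficients, compared on vectors whose low
coordinates vanish for the first one and whose high coordinates vanish for the second one. -/
theorem exists_ne_zero_mul_sum_sq_le (hd : Fintype.card ι = d)
    (P Q : (ι → ℝ) →ₗ[ℝ] (Fin d → ℝ)) {a b : Fin d → ℝ} (ha : Monotone a) (hb : Monotone b)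
    {δ : ℝ} (h : ∀ x, ∑ i, a i * P x i ^ 2 ≤ ∑ i, b i * Q x i ^ 2 + δ * (x ⬝ᵥ x)) (k : Fin d) :
    ∃ x ≠ 0, a k * ∑ i, P x i ^ 2 ≤ b k * ∑ i, Q x i ^ 2 + δ * (x ⬝ᵥ x) := by
  obtain ⟨x, hx0, hP, hQ⟩ := exists_ne_zero_of_vanishing hd P Q k
  refine ⟨x, hx0, ?_⟩
  have h1 : a k * ∑ i, P x i ^ 2 ≤ ∑ i, a i * P x i ^ 2 := by
    rw [Finset.mul_sum]
    refine Finset.sum_le_sum fun i _ => ?_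
    rcases lt_or_ge i k with hi | hi
    · simp [hP i hi]
    · exact mul_le_mul_of_nonneg_right (ha hi) (sq_nonneg _)
  have h2 : ∑ i, b i * Q x i ^ 2 ≤ b k * ∑ i, Q x i ^ 2 := by
    rw [Finset.mul_sum]
    refine Finset.sum_le_sum fun i _ => ?_
    rcases lt_or_ge k i with hi | hi
    · simp [hQ i hi]
    · exact mul_le_mul_of_nonneg_right (hb hi) (sq_nonneg _)
  linarith [h x]

theorem dotProduct_self_pos_of_ne_zero {x : ι → ℝ} (hx : x ≠ 0) : 0 < x ⬝ᵥ x := by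
  simpa using Matrix.dotProduct_star_self_pos_iff.2 hx

/-- Perturbation bound, both additive (`δ`) and multiplicative (`ε`), for the ordered coefficients
of a diagonal quadratic form. -/
theorem abs_sub_le_of_forms_close (hd : Fintype.card ι = d)
    (P Q : (ι → ℝ) →ₗ[ℝ] (Fin d → ℝ)) {a b : Fin d → ℝ} (ha : Monotone a) (hb : Monotone b)
    {δ ε : ℝ} (hP : ∀ x, ∑ i, P x i ^ 2 = x ⬝ᵥ x)
    (hQ : ∀ x, |∑ i, Q x i ^ 2 - x ⬝ᵥ x| ≤ ε * (x ⬝ᵥ x))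
    (h : ∀ x, |∑ i, a i * P x i ^ 2 - ∑ i, b i * Q x i ^ 2| ≤ δ * (x ⬝ᵥ x)) (k : Fin d) :
    |a k - b k| ≤ ε * |b k| + δ := by
  have key : ∀ x, |b k * ∑ i, Q x i ^ 2 - b k * (x ⬝ᵥ x)| ≤ ε * |b k| * (x ⬝ᵥ x) := fun x => by
    rw [← mul_sub, abs_mul]
    nlinarith [mul_le_mul_of_nonneg_left (hQ x) (abs_nonneg (b k))]
  obtain ⟨x, hx0, hx⟩ := exists_ne_zero_mul_sum_sq_le hd P Q ha hb (δ := δ)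
    (fun x => by linarith [(abs_le.1 (h x)).2]) k
  obtain ⟨y, hy0, hy⟩ := exists_ne_zero_mul_sum_sq_le hd Q P hb ha (δ := δ)
    (fun x => by linarith [(abs_le.1 (h x)).1]) k
  have hxp := dotProduct_self_pos_of_ne_zero hx0
  have hyp := dotProduct_self_pos_of_ne_zero hy0
  rw [hP] at hx hy
  have kx := (abs_le.1 (key x)).2
  have ky := (abs_le.1 (key y)).1
  rw [abs_le]
  constructor
  · refine le_of_mul_le_mul_right ?_ hyp
    linarith
  · refine le_of_mul_le_mul_right ?_ hxp
    linarith

end Perturbation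

section SortedSpectrum

variable {ι : Type*} [Fintype ι] {d : ℕ}

/-- `A = V diag(a) Vᵀ` with `V` orthogonal and `a` increasing. -/
structure IsSortedSpectrum [DecidableEq ι] (A : Matrix ι ι ℝ) (V : Matrix ι (Fin d) ℝ)
    (a : Fin d → ℝ) : Prop where
  mono : Monotone a
  mul_transpose : V * Vᵀ = 1
  eq : A = V * diagonal a * Vᵀ

theorem exists_isSortedSpectrum [DecidableEq ι] {A : Matrix ι ι ℝ} (hA : Aᵀ = A)
    (hd : Fintype.card ι = d) :
    ∃ (V : Matrix ι (Fin d) ℝ) (a : Fin d → ℝ), IsSortedSpectrum A V a := by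
  have hA' : A.IsHermitian := by
    rwa [Matrix.IsHermitian, Matrix.conjTranspose_eq_transpose_of_trivial]
  let e : Fin d ≃ ι := (Fintype.equivFinOfCardEq hd).symm
  let s : Fin d ≃ ι := (Tuple.sort (hA'.eigenvalues ∘ e)).trans e
  let U : Matrix ι ι ℝ := hA'.eigenvectorUnitary
  have hU : U * Uᵀ = 1 := by
    have := Unitary.coe_mul_star_self hA'.eigenvectorUnitary
    rwa [Unitary.coe_star, star_eq_conjTranspose,
      Matrix.conjTranspose_eq_transpose_of_trivial] at this
  have hs : A = U * diagonal hA'.eigenvalues * Uᵀ := by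
    have := hA'.spectral_theorem
    rw [Unitary.conjStarAlgAut_apply, star_eq_conjTranspose,
      Matrix.conjTranspose_eq_transpose_of_trivial] at this
    exact this
  refine ⟨U.submatrix id s, hA'.eigenvalues ∘ s,
    Tuple.monotone_sort (hA'.eigenvalues ∘ e), ?_, ?_⟩
  · rw [transpose_submatrix, submatrix_mul_equiv, hU]; simp
  · conv_lhs => rw [hs]
    rw [← submatrix_diagonal_equiv, submatrix_mul_equiv, transpose_submatrix, submatrix_mul_equiv]
    simp

theorem sum_mul_transpose_mulVec_sq {κ : Type*} [Fintype κ] [DecidableEq κ] (Z : Matrix ι κ ℝ)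
    (b : κ → ℝ) (x : ι → ℝ) :
    ∑ i, b i * (Zᵀ *ᵥ x) i ^ 2 = x ⬝ᵥ (Z * diagonal b * Zᵀ) *ᵥ x := by
  rw [Matrix.mul_assoc, ← mulVec_mulVec, ← mulVec_mulVec, dotProduct_mulVec, ← mulVec_transpose]
  simp only [dotProduct, mulVec_diagonal]
  exact Finset.sum_congr rfl fun i _ => by ring

theorem sum_transpose_mulVec_sq {κ : Type*} [Fintype κ] [DecidableEq κ] (Z : Matrix ι κ ℝ)
    (x : ι → ℝ) : ∑ i, (Zᵀ *ᵥ x) i ^ 2 = x ⬝ᵥ (Z * Zᵀ) *ᵥ x := by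
  simpa [show (diagonal fun _ : κ => (1 : ℝ)) = 1 from diagonal_one] using
    sum_mul_transpose_mulVec_sq Z (fun _ => 1) x

theorem abs_dotProduct_mulVec_le {E : Matrix ι ι ℝ} {ε : ℝ} (hE : ∀ i j, |E i j| ≤ ε)
    (x : ι → ℝ) : |x ⬝ᵥ E *ᵥ x| ≤ Fintype.card ι * ε * (x ⬝ᵥ x) := by
  have h1 : |x ⬝ᵥ E *ᵥ x| ≤ ∑ i, ∑ j, ε * ((x i ^ 2 + x j ^ 2) / 2) := by
    simp only [dotProduct, mulVec, Finset.mul_sum]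
    refine (Finset.abs_sum_le_sum_abs _ _).trans (Finset.sum_le_sum fun i _ => ?_)
    refine (Finset.abs_sum_le_sum_abs _ _).trans (Finset.sum_le_sum fun j _ => ?_)
    rw [abs_mul, abs_mul]
    have := mul_nonneg (abs_nonneg (x i)) (abs_nonneg (x j))
    have h2 : |x i| * |x j| ≤ (x i ^ 2 + x j ^ 2) / 2 := by
      nlinarith [sq_nonneg (|x i| - |x j|), sq_abs (x i), sq_abs (x j)]
    nlinarith [hE i j, abs_nonneg (E i j)]
  refine h1.trans_eq ?_
  simp only [← Finset.mul_sum, add_div, Finset.sum_add_distrib, Finset.sum_const, Finset.card_univ,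
    nsmul_eq_mul, dotProduct, ← Finset.sum_div, ← pow_two]
  ring

/-- If `A` is close to `Z diag(b) Zᵀ` and `Z Zᵀ` is close to the identity, the eigenvalues of `A`
are close to the sorted entries of `b`. -/
theorem IsSortedSpectrum.abs_sub_le [DecidableEq ι] {κ : Type*} [Fintype κ] [DecidableEq κ]
    {A : Matrix ι ι ℝ} {V : Matrix ι (Fin d) ℝ} {a : Fin d → ℝ} (hA : IsSortedSpectrum A V a)
    (hd : Fintype.card ι = d) (Z : Matrix ι κ ℝ) (b : κ → ℝ) (σ : Fin d ≃ κ) (hσ : Monotone (b ∘ σ))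
    {δ ε : ℝ} (hZ : ∀ i j, |(Z * Zᵀ - 1 : Matrix ι ι ℝ) i j| ≤ ε)
    (hAZ : ∀ i j, |(A - Z * diagonal b * Zᵀ : Matrix ι ι ℝ) i j| ≤ δ) (k : Fin d) :
    |a k - b (σ k)| ≤ Fintype.card ι * ε * |b (σ k)| + Fintype.card ι * δ := by
  refine abs_sub_le_of_forms_close hd (mulVecLin Vᵀ) (mulVecLin (Z.submatrix id σ)ᵀ)
    (b := b ∘ σ) hA.mono hσ (fun x => ?_) (fun x => ?_) (fun x => ?_) k
  · simp only [mulVecLin_apply, sum_transpose_mulVec_sq, hA.mul_transpose, one_mulVec]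
  · have := abs_dotProduct_mulVec_le hZ x
    simp only [mulVecLin_apply, sum_transpose_mulVec_sq]
    rw [transpose_submatrix, submatrix_mul_equiv]
    simpa [sub_mulVec, dotProduct_sub] using this
  · have := abs_dotProduct_mulVec_le hAZ x
    simp only [mulVecLin_apply, sum_mul_transpose_mulVec_sq]
    rw [← hA.eq, ← submatrix_diagonal_equiv, submatrix_mul_equiv, transpose_submatrix,
      submatrix_mul_equiv]
    simpa [sub_mulVec, dotProduct_sub] using this

theorem IsSortedSpectrum.roots_charpoly [DecidableEq ι] {A : Matrix ι ι ℝ} {V : Matrix ι (Fin d) ℝ}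
    {a : Fin d → ℝ} (hA : IsSortedSpectrum A V a) (hd : Fintype.card ι = d) :
    A.charpoly.roots = Multiset.map a Finset.univ.val := by
  let e : ι ≃ Fin d := Fintype.equivFinOfCardEq hd
  have h1 : V.submatrix id e * (V.submatrix id e)ᵀ = 1 := by
    rw [transpose_submatrix, submatrix_mul_equiv, hA.mul_transpose]; simp
  have h2 : A = V.submatrix id e * (diagonal (a ∘ e) * (V.submatrix id e)ᵀ) := by
    rw [transpose_submatrix, ← submatrix_diagonal_equiv, submatrix_mul_equiv, submatrix_mul_equiv,
      ← Matrix.mul_assoc, ← hA.eq]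
    simp
  rw [h2, charpoly_mul_comm, Matrix.mul_assoc, mul_eq_one_comm.1 h1, Matrix.mul_one,
    charpoly_diagonal, Polynomial.roots_prod _ _ (Finset.prod_ne_zero_iff.2 fun i _ =>
      Polynomial.X_sub_C_ne_zero _)]
  simp only [Polynomial.roots_X_sub_C, Multiset.bind_singleton]
  rw [← Multiset.map_map, ← Finset.map_univ_equiv e, Finset.map_val]
  rfl

end SortedSpectrum

section FormalDiagonalization

open PowerSeries in
/-- A power series not divisible by `X ^ n` divides `X ^ n` with a quotient vanishing at `0`. -/
theorem PowerSeries.exists_mul_eq_of_not_X_pow_dvd {n : ℕ} {d c : PowerSeries ℝ}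
    (hd : ¬ (X : PowerSeries ℝ) ^ n ∣ d) (hc : (X : PowerSeries ℝ) ^ n ∣ c) :
    ∃ k, d * k = c ∧ X ∣ k := by
  have hd0 : d ≠ 0 := by rintro rfl; exact hd (dvd_zero _)
  obtain ⟨l, u, hu⟩ := IsDiscreteValuationRing.associated_pow_irreducible hd0 X_irreducible
  have hln : l < n := by
    by_contra! h
    exact hd ((pow_dvd_pow _ h).trans ⟨_, (by rw [← hu, mul_assoc, Units.mul_inv, mul_one] :
      d = X ^ l * ↑u⁻¹)⟩)
  obtain ⟨t, rfl⟩ := hc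
  refine ⟨(u : PowerSeries ℝ) * X ^ (n - l) * t, ?_, ?_⟩
  · rw [← mul_assoc, ← mul_assoc, hu, ← pow_add, Nat.add_sub_cancel' hln.le]
  · exact ((dvd_pow_self _ (Nat.sub_ne_zero_of_lt hln)).mul_left _).mul_right _

variable {ι : Type*} [Fintype ι]

theorem mul_dvd_matrix_mul_apply {R : Type*} [CommRing R] {M N : Matrix ι ι R} {x y : R}
    (hM : ∀ i j, x ∣ M i j) (hN : ∀ i j, y ∣ N i j) (i j : ι) : x * y ∣ (M * N) i j :=
  Finset.dvd_sum fun _ _ => mul_dvd_mul (hM _ _) (hN _ _)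

theorem dvd_matrix_mul_mul_apply {R : Type*} [CommRing R] {M : Matrix ι ι R} {x : R}
    (hM : ∀ i j, x ∣ M i j) (P Q : Matrix ι ι R) (i j : ι) : x ∣ (P * M * Q) i j := by
  refine Finset.dvd_sum fun l _ => Dvd.dvd.mul_right ?_ _
  exact Finset.dvd_sum fun m _ => (hM _ _).mul_left _

variable [DecidableEq ι]

/-- Conjugation by the Cayley transform of a small skew-symmetric matrix. -/
theorem exists_orthogonal_conj_sub_commutator {A H : Matrix ι ι (PowerSeries ℝ)}
    (hH : Hᵀ = -H) (hX : ∀ i j, PowerSeries.X ∣ H i j) {n : ℕ}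
    (hAH : ∀ i j, PowerSeries.X ^ n ∣ (A * H - H * A) i j) :
    ∃ U : Matrix ι ι (PowerSeries ℝ), U * Uᵀ = 1 ∧
      ∀ i j, PowerSeries.X ^ (n + 1) ∣ (Uᵀ * A * U - A - 2 • (A * H - H * A)) i j := by
  set G := A * H - H * A with hG
  have hunit : IsUnit (1 - H).det := by
    rw [PowerSeries.isUnit_iff_constantCoeff, RingHom.map_det]
    have : (PowerSeries.constantCoeff (R := ℝ)).mapMatrix (1 - H) = 1 := by
      rw [map_sub, map_one, sub_eq_self]
      ext i j
      simpa using PowerSeries.X_dvd_iff.1 (hX i j)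
    simp [this]
  have h1 : (1 - H) * (1 - H)⁻¹ = 1 := mul_nonsing_inv _ hunit
  have h2 : (1 - H)⁻¹ * (1 - H) = 1 := nonsing_inv_mul _ hunit
  set I := (1 - H)⁻¹
  have hT : (1 - H)ᵀ = 1 + H := by rw [transpose_sub, hH, transpose_one, sub_neg_eq_add]
  have hT' : (1 + H)ᵀ = 1 - H := by rw [← hT, transpose_transpose]
  have h3 : Iᵀ * (1 + H) = 1 := by rw [← hT, ← transpose_mul, h1, transpose_one]
  have h4 : (1 + H) * Iᵀ = 1 := by rw [← hT, ← transpose_mul, h2, transpose_one]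
  have hc : (1 + H) * (1 - H) = (1 - H) * (1 + H) := by noncomm_ring
  refine ⟨(1 + H) * I, ?_, fun i j => ?_⟩
  · rw [transpose_mul, hT']
    calc (1 + H) * I * (Iᵀ * (1 - H))
        = I * ((1 - H) * (1 + H)) * I * (Iᵀ * (1 - H)) := by
          rw [← Matrix.mul_assoc I, h2, Matrix.one_mul]
      _ = I * ((1 + H) * ((1 - H) * I) * Iᵀ) * (1 - H) := by
          rw [← hc]; simp only [Matrix.mul_assoc]
      _ = 1 := by rw [h1, Matrix.mul_one, h4, Matrix.mul_one, h2]
  · have hE : ((1 + H) * I)ᵀ * A * ((1 + H) * I) - A - 2 • G =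
        Iᵀ * (2 • (G * H - H * G + H * G * H)) * I := by
      rw [transpose_mul, hT']
      have e1 : A + 2 • G = Iᵀ * ((1 + H) * (A + 2 • G) * (1 - H)) * I := by
        calc A + 2 • G = (Iᵀ * (1 + H)) * (A + 2 • G) * ((1 - H) * I) := by
              rw [h3, h1, Matrix.one_mul, Matrix.mul_one]
          _ = _ := by simp only [Matrix.mul_assoc]
      rw [sub_sub, e1]
      rw [show Iᵀ * (1 - H) * A * ((1 + H) * I) = Iᵀ * ((1 - H) * A * (1 + H)) * I by
        simp only [Matrix.mul_assoc], ← Matrix.sub_mul, ← Matrix.mul_sub]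
      congr 2
      rw [hG]
      noncomm_ring
    rw [hE]
    refine dvd_matrix_mul_mul_apply (fun i j => ?_) _ _ i j
    have d1 : PowerSeries.X ^ (n + 1) ∣ (G * H) i j := by
      rw [pow_succ]; exact mul_dvd_matrix_mul_apply hAH hX i j
    have d2 : ∀ i j, PowerSeries.X ^ (n + 1) ∣ (H * G) i j := fun i j => by
      rw [pow_succ']; exact mul_dvd_matrix_mul_apply hX hAH i j
    have d3 : PowerSeries.X ^ (n + 1) ∣ (H * G * H) i j := by
      simpa using mul_dvd_matrix_mul_apply d2 (fun i j => one_dvd (H i j)) i j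
    rw [Matrix.smul_apply, nsmul_eq_mul]
    exact ((d1.sub (d2 i j)).add d3).mul_left _

/-- Orthogonal diagonalization of a real symmetric block matrix, within the blocks. -/
theorem exists_orthogonal_diagonalizing_blocks {γ : Type*} [Fintype γ] [DecidableEq γ] (g : ι → γ)
    {C : Matrix ι ι ℝ} (hC : Cᵀ = C) (hg : ∀ i j, g i ≠ g j → C i j = 0) :
    ∃ Q : Matrix ι ι ℝ, Q * Qᵀ = 1 ∧ (∀ i j, g i ≠ g j → Q i j = 0) ∧
      ∀ i j, i ≠ j → (Qᵀ * C * Q) i j = 0 := by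
  have hex : ∀ c : γ, ∃ (V : Matrix {i // g i = c} {i // g i = c} ℝ) (a : {i // g i = c} → ℝ),
      V * Vᵀ = 1 ∧ C.submatrix Subtype.val Subtype.val = V * diagonal a * Vᵀ := fun c => by
    have e := Fintype.equivFin {i // g i = c}
    obtain ⟨V, a, h⟩ := exists_isSortedSpectrum
      (A := C.submatrix (Subtype.val : {i // g i = c} → ι) Subtype.val)
      (by rw [transpose_submatrix, hC]) rfl
    refine ⟨V.submatrix id e, a ∘ e, ?_, ?_⟩
    · rw [transpose_submatrix, submatrix_mul_equiv, h.mul_transpose]; simp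
    · conv_lhs => rw [h.eq]
      rw [← submatrix_diagonal_equiv, submatrix_mul_equiv, transpose_submatrix,
        submatrix_mul_equiv]
      simp
  choose V a hV hCV using hex
  let e := Equiv.sigmaFiberEquiv g
  have hC' : C =
      (blockDiagonal' fun c => V c * diagonal (a c) * (V c)ᵀ).submatrix e.symm e.symm := by
    have : C.submatrix e e = blockDiagonal' fun c => V c * diagonal (a c) * (V c)ᵀ := by
      ext ⟨c, i, rfl⟩ ⟨c', j, rfl⟩
      simp only [← hCV, submatrix_apply, blockDiagonal'_apply]
      split_ifs with h
      · have hcast : ∀ (c : γ) (h : g j = c), j = (cast (congrArg (fun c => {i // g i = c}) h)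
            (⟨j, rfl⟩ : {i // g i = g j})).1 := by rintro _ rfl; rfl
        exact congrArg (C i) (hcast _ h.symm)
      · exact hg i j h
    rw [← this]
    simp
  have hV' : ∀ c, (V c)ᵀ * V c = 1 := fun c => mul_eq_one_comm.1 (hV c)
  refine ⟨(blockDiagonal' V).submatrix e.symm e.symm, ?_, fun i j h => ?_, fun i j h => ?_⟩
  · rw [transpose_submatrix, submatrix_mul_equiv, blockDiagonal'_transpose, ← blockDiagonal'_mul]
    rw [show (fun k => V k * (V k)ᵀ) = 1 from funext hV, blockDiagonal'_one]
    simp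
  · rw [submatrix_apply, blockDiagonal'_apply,
      dif_neg (by simpa [e, Equiv.sigmaFiberEquiv] using h)]
  · rw [hC', transpose_submatrix, submatrix_mul_equiv, submatrix_mul_equiv,
      blockDiagonal'_transpose, ← blockDiagonal'_mul, ← blockDiagonal'_mul]
    have : ∀ c, (V c)ᵀ * (V c * diagonal (a c) * (V c)ᵀ) * V c = diagonal (a c) := fun c => by
      rw [Matrix.mul_assoc, Matrix.mul_assoc, hV', Matrix.mul_one, ← Matrix.mul_assoc, hV',
        Matrix.one_mul]
    simp only [this, blockDiagonal'_diagonal, submatrix_diagonal_equiv]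
    exact diagonal_apply_ne _ h

theorem exists_orthogonal_offDiag_X_pow_succ_dvd {A : Matrix ι ι (PowerSeries ℝ)} (hA : Aᵀ = A)
    {n : ℕ} (hn : ∀ i j, i ≠ j → PowerSeries.X ^ n ∣ A i j) :
    ∃ U : Matrix ι ι (PowerSeries ℝ), U * Uᵀ = 1 ∧
      ∀ i j, i ≠ j → PowerSeries.X ^ (n + 1) ∣ (Uᵀ * A * U) i j := by
  classical
  have hAs : ∀ i j, A j i = A i j := fun i j => congrFun (congrFun hA i) j
  let s : Setoid ι :=
    { r := fun i j => PowerSeries.X ^ n ∣ A i i - A j j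
      iseqv := ⟨fun i => by simp, fun h => by rw [dvd_sub_comm]; exact h,
        fun h h' => by simpa using dvd_add h h'⟩ }
  let g : ι → Quotient s := Quotient.mk s
  have hg : ∀ i j, g i = g j ↔ PowerSeries.X ^ n ∣ A i i - A j j := fun i j => Quotient.eq
  have hex : ∀ i j, ∃ k, g i ≠ g j → (A i i - A j j) * k = -(1 / 2 : ℝ) • A i j ∧
      PowerSeries.X ∣ k := fun i j => by
    by_cases h : g i = g j
    · exact ⟨0, fun h' => absurd h h'⟩
    · have hij : i ≠ j := fun hij => h (by rw [hij])
      obtain ⟨k, hk⟩ := PowerSeries.exists_mul_eq_of_not_X_pow_dvd (fun h' => h ((hg i j).2 h'))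
        (dvd_smul_of_dvd (-(1 / 2 : ℝ)) (hn i j hij))
      exact ⟨k, fun _ => hk⟩
  choose k hk using hex
  let H : Matrix ι ι (PowerSeries ℝ) := of fun i j => if g i = g j then 0 else k i j
  have hX : ∀ i j, PowerSeries.X ∣ H i j := fun i j => by
    simp only [H, of_apply]; split_ifs with h
    · exact dvd_zero _
    · exact (hk i j h).2
  have hH : Hᵀ = -H := by
    ext1 i j
    simp only [transpose_apply, Matrix.neg_apply, H, of_apply, eq_comm (a := g j)]
    split_ifs with h
    · simp
    · have hd : A i i - A j j ≠ 0 := fun h0 => h ((hg i j).2 (by rw [h0]; exact dvd_zero _))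
      refine mul_left_cancel₀ hd ?_
      have h1 := (hk i j h).1
      have h2 := (hk j i (Ne.symm h)).1
      rw [hAs i j] at h2
      linear_combination h1 - h2
  let F : Matrix ι ι (PowerSeries ℝ) := A - diagonal fun i => A i i
  have hF : ∀ i j, PowerSeries.X ^ n ∣ F i j := fun i j => by
    rcases eq_or_ne i j with rfl | h
    · simp [F]
    · simpa [F, h] using hn i j h
  have hcomm : ∀ i j, (A * H - H * A) i j =
      (A i i - A j j) * H i j + ((F * H) i j - (H * F) i j) := fun i j => by
    have : A = diagonal (fun i => A i i) + F := by simp [F]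
    conv_lhs => rw [this]
    simp only [Matrix.add_mul, Matrix.mul_add, Matrix.sub_apply, Matrix.add_apply, diagonal_mul,
      mul_diagonal]
    ring
  have hrest : ∀ i j, PowerSeries.X ^ (n + 1) ∣ (F * H) i j - (H * F) i j := fun i j =>
    dvd_sub (by rw [pow_succ]; exact mul_dvd_matrix_mul_apply hF hX i j)
      (by rw [pow_succ']; exact mul_dvd_matrix_mul_apply hX hF i j)
  have hdiag : ∀ i j, (A i i - A j j) * H i j = if g i = g j then 0 else -(1 / 2 : ℝ) • A i j :=
    fun i j => by
      simp only [H, of_apply]; split_ifs with h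
      · simp
      · exact (hk i j h).1
  obtain ⟨U, hU, hUA⟩ := exists_orthogonal_conj_sub_commutator (A := A) hH hX (n := n)
    fun i j => by
      rw [hcomm, hdiag]
      refine dvd_add ?_ ((pow_dvd_pow _ n.le_succ).trans (hrest i j))
      split_ifs with h
      · exact dvd_zero _
      · exact dvd_smul_of_dvd _ (hn i j fun hij => h (by rw [hij]))
  let A' : Matrix ι ι (PowerSeries ℝ) := of fun i j => if g i = g j then A i j else 0
  have hB : ∀ i j, PowerSeries.X ^ (n + 1) ∣ (Uᵀ * A * U - A') i j := fun i j => by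
    have h1 : (Uᵀ * A * U - A') i j = (Uᵀ * A * U - A - 2 • (A * H - H * A)) i j +
        2 * ((F * H) i j - (H * F) i j) := by
      rw [Matrix.sub_apply, Matrix.sub_apply, Matrix.sub_apply, Matrix.smul_apply, hcomm, hdiag]
      simp only [A', of_apply]
      split_ifs with h
      · simp only [nsmul_eq_mul]; push_cast; ring
      · have : (2 : PowerSeries ℝ) * (-(1 / 2 : ℝ) • A i j) = -A i j := by
          rw [two_mul, ← add_smul]; norm_num
        simp only [nsmul_eq_mul]; push_cast
        linear_combination this
    rw [h1]
    exact dvd_add (hUA i j) ((hrest i j).mul_left _)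
  let δ : ι → PowerSeries ℝ := fun i => A (g i).out (g i).out
  have hδ : ∀ i j, PowerSeries.X ^ n ∣ (A' - diagonal δ) i j := fun i j => by
    rcases eq_or_ne i j with rfl | h
    · simp only [A', δ, of_apply, Matrix.sub_apply, if_true, diagonal_apply_eq]
      exact (hg _ _).1 (Quotient.out_eq _).symm
    · simp only [A', of_apply, Matrix.sub_apply, diagonal_apply_ne _ h, sub_zero]
      split_ifs
      · exact hn i j h
      · exact dvd_zero _
  choose C hC using hδ
  have hX0 : (PowerSeries.X : PowerSeries ℝ) ^ n ≠ 0 := pow_ne_zero _ PowerSeries.X_ne_zero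
  have hCs : ∀ i j, C j i = C i j := fun i j => by
    refine mul_left_cancel₀ hX0 ?_
    rw [← hC, ← hC, Matrix.sub_apply, Matrix.sub_apply, ← diagonal_transpose δ, transpose_apply]
    simp only [A', of_apply, hAs i j, eq_comm (a := g j), diagonal_transpose]
  have hCg : ∀ i j, g i ≠ g j → C i j = 0 := fun i j h => by
    have hij : i ≠ j := fun hij => h (by rw [hij])
    refine (mul_eq_zero.1 ((hC i j).symm.trans ?_)).resolve_left hX0
    simp [A', h, hij]
  let C₀ : Matrix ι ι ℝ := of fun i j => PowerSeries.constantCoeff (C i j)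
  obtain ⟨Q, hQ, hQg, hQC⟩ := exists_orthogonal_diagonalizing_blocks g (C := C₀)
    (by ext i j; simp [C₀, hCs i j]) (fun i j h => by simp [C₀, hCg i j h])
  let P : Matrix ι ι (PowerSeries ℝ) := (PowerSeries.C (R := ℝ)).mapMatrix Q
  have hPt : Pᵀ = (PowerSeries.C (R := ℝ)).mapMatrix Qᵀ := rfl
  have hP : P * Pᵀ = 1 := by rw [hPt, ← map_mul, hQ, map_one]
  have hPδ : Pᵀ * diagonal δ * P = diagonal δ := by
    have : diagonal δ * P = P * diagonal δ := by
      ext1 i j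
      rw [diagonal_mul, mul_diagonal, mul_comm]
      by_cases h : g i = g j
      · simp only [δ, h]
      · simp [P, hQg i j h]
    rw [Matrix.mul_assoc, this, ← Matrix.mul_assoc, mul_eq_one_comm.1 hP, Matrix.one_mul]
  refine ⟨U * P, ?_, fun i j hij => ?_⟩
  · rw [transpose_mul, Matrix.mul_assoc, ← Matrix.mul_assoc P, hP, Matrix.one_mul, hU]
  · have e1 : (U * P)ᵀ * A * (U * P) = Pᵀ * (Uᵀ * A * U - A') * P + diagonal δ +
        (PowerSeries.X ^ n : PowerSeries ℝ) • (Pᵀ * (of C) * P) := by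
      have e2 : A' = diagonal δ + (PowerSeries.X ^ n : PowerSeries ℝ) • of C := by
        ext1 i j
        rw [Matrix.add_apply, Matrix.smul_apply, of_apply, smul_eq_mul, ← hC, Matrix.sub_apply]
        ring
      have e3 : Pᵀ * A' * P = diagonal δ + (PowerSeries.X ^ n : PowerSeries ℝ) •
          (Pᵀ * (of C) * P) := by
        conv_lhs => rw [e2]
        rw [Matrix.mul_add, Matrix.add_mul, hPδ, Matrix.mul_smul, Matrix.smul_mul]
      rw [Matrix.mul_sub, Matrix.sub_mul, e3, transpose_mul]
      simp only [Matrix.mul_assoc]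
      abel
    rw [e1, Matrix.add_apply, Matrix.add_apply, diagonal_apply_ne _ hij, add_zero,
      Matrix.smul_apply, smul_eq_mul, pow_succ]
    refine dvd_add ?_ (mul_dvd_mul_left _ ?_)
    · rw [← pow_succ]; exact dvd_matrix_mul_mul_apply hB _ _ i j
    · rw [PowerSeries.X_dvd_iff]
      have e4 : (PowerSeries.constantCoeff (R := ℝ)).mapMatrix (Pᵀ * of C * P) = Qᵀ * C₀ * Q := by
        rw [map_mul, map_mul]
        congr 1
      have := congrFun (congrFun e4 i) j
      rw [hQC i j hij] at this
      exact this

/-- Formal Rellich theorem: a symmetric matrix of power series is diagonalized, to any prescribed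
order, by an orthogonal matrix of power series. -/
theorem exists_orthogonal_offDiag_X_pow_dvd {A : Matrix ι ι (PowerSeries ℝ)} (hA : Aᵀ = A)
    (n : ℕ) : ∃ U : Matrix ι ι (PowerSeries ℝ), U * Uᵀ = 1 ∧
      ∀ i j, i ≠ j → PowerSeries.X ^ n ∣ (Uᵀ * A * U) i j := by
  induction n with
  | zero => exact ⟨1, by simp, by simp⟩
  | succ n ih =>
    obtain ⟨U, hU, hUA⟩ := ih
    obtain ⟨U', hU', h⟩ := exists_orthogonal_offDiag_X_pow_succ_dvd (A := Uᵀ * A * U)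
      (by simp [hA, Matrix.mul_assoc]) hUA
    refine ⟨U * U', ?_, fun i j hij => ?_⟩
    · rw [transpose_mul, Matrix.mul_assoc, ← Matrix.mul_assoc U', hU', Matrix.one_mul, hU]
    · simpa [transpose_mul, Matrix.mul_assoc] using h i j hij

end FormalDiagonalization

section Expansion

open Filter Topology Asymptotics

theorem Polynomial.isBigO_one_nhds (P : Polynomial ℝ) (l : Filter ℝ) (hl : l ≤ 𝓝 0) :
    (fun h => P.eval h) =O[l] fun _ => (1 : ℝ) :=
  (P.continuous.continuousAt.tendsto.mono_left hl).isBigO_one ℝ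

theorem Polynomial.isBigO_pow_of_X_pow_dvd {P : Polynomial ℝ} {n : ℕ} (hP : Polynomial.X ^ n ∣ P)
    (l : Filter ℝ) (hl : l ≤ 𝓝 0) : (fun h => P.eval h) =O[l] fun h => h ^ n := by
  obtain ⟨Q, rfl⟩ := hP
  simpa using (isBigO_refl (fun h : ℝ => h ^ n) l).mul (Q.isBigO_one_nhds l hl)

theorem isBigO_pow_of_le {m n : ℕ} (hmn : m ≤ n) {l : Filter ℝ} (hl : l ≤ 𝓝 0) :
    (fun h : ℝ => h ^ n) =O[l] fun h => h ^ m := by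
  simpa using Polynomial.isBigO_pow_of_X_pow_dvd (pow_dvd_pow Polynomial.X hmn) l hl

theorem Polynomial.X_pow_dvd_of_isBigO {P : Polynomial ℝ} {n : ℕ}
    (hP : (fun h => P.eval h) =O[𝓝[>] 0] fun h => h ^ n) : Polynomial.X ^ n ∣ P := by
  induction n generalizing P with
  | zero => simp
  | succ n ih =>
    have h0 : P.eval 0 = 0 := by
      have h1 : Tendsto (fun h : ℝ => h ^ (n + 1)) (𝓝[>] 0) (𝓝 0) := by
        have : Tendsto (fun h : ℝ => h ^ (n + 1)) (𝓝 0) (𝓝 (0 ^ (n + 1))) :=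
          (continuous_pow (n + 1)).tendsto 0
        rw [zero_pow n.succ_ne_zero] at this
        exact this.mono_left nhdsWithin_le_nhds
      exact tendsto_nhds_unique
        (P.continuous.continuousAt.tendsto.mono_left nhdsWithin_le_nhds) (hP.trans_tendsto h1)
    obtain ⟨Q, rfl⟩ : Polynomial.X ∣ P := by
      rwa [Polynomial.X_dvd_iff, Polynomial.coeff_zero_eq_eval_zero]
    rw [pow_succ']
    refine mul_dvd_mul_left _ (ih ?_)
    have h2 := (isBigO_refl (fun h : ℝ => h⁻¹) (𝓝[>] 0)).mul hP
    refine h2.congr' ?_ ?_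
    · filter_upwards [self_mem_nhdsWithin] with h hh
      rw [Polynomial.eval_mul, Polynomial.eval_X, inv_mul_cancel_left₀ (Set.mem_Ioi.1 hh).ne']
    · filter_upwards [self_mem_nhdsWithin] with h hh
      rw [pow_succ', inv_mul_cancel_left₀ (Set.mem_Ioi.1 hh).ne']

theorem eq_zero_of_isBigO_pow_succ {f : ℝ → ℝ} {n : ℕ}
    (hf : f =O[𝓝[≥] 0] fun h => h ^ (n + 1)) : f 0 = 0 := by
  obtain ⟨C, hC⟩ := hf.bound
  simpa using hC.self_of_nhdsWithin Set.self_mem_Ici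

/-- `f` has a classical expansion in powers of `h` as `h → 0⁺`, the leading coefficient being the
value at `0`. -/
def HasExpansion (f : ℝ → ℝ) : Prop :=
  ∀ n : ℕ, ∃ P : Polynomial ℝ, (fun h => f h - P.eval h) =O[𝓝[≥] 0] fun h => h ^ n

namespace HasExpansion

variable {f g : ℝ → ℝ}

theorem const (c : ℝ) : HasExpansion fun _ => c := fun n =>
  ⟨Polynomial.C c, by simpa using isBigO_zero _ _⟩

theorem add (hf : HasExpansion f) (hg : HasExpansion g) : HasExpansion fun h => f h + g h :=
  fun n => by
    obtain ⟨P, hP⟩ := hf n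
    obtain ⟨Q, hQ⟩ := hg n
    refine ⟨P + Q, (hP.add hQ).congr_left fun h => ?_⟩
    rw [Polynomial.eval_add]; ring

theorem isBigO_one (hf : HasExpansion f) : f =O[𝓝[≥] 0] fun _ => (1 : ℝ) := by
  obtain ⟨P, hP⟩ := hf 0
  have h1 := (hP.congr_right fun h => pow_zero h).add
    (P.isBigO_one_nhds (𝓝[≥] 0) nhdsWithin_le_nhds)
  exact h1.congr_left fun h => sub_add_cancel _ _

theorem mul (hf : HasExpansion f) (hg : HasExpansion g) : HasExpansion fun h => f h * g h :=
  fun n => by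
    obtain ⟨P, hP⟩ := hf n
    obtain ⟨Q, hQ⟩ := hg n
    have h1 := (hP.mul hg.isBigO_one).add
      ((hQ.mul (P.isBigO_one_nhds _ nhdsWithin_le_nhds)).congr_right fun h => rfl)
    refine ⟨P * Q, (h1.congr_right fun h => mul_one _).congr_left fun h => ?_⟩
    rw [Polynomial.eval_mul]; ring

theorem neg (hf : HasExpansion f) : HasExpansion fun h => -f h := by
  simpa using (const (-1)).mul hf

theorem sub (hf : HasExpansion f) (hg : HasExpansion g) : HasExpansion fun h => f h - g h := by
  simpa [sub_eq_add_neg] using hf.add hg.neg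

theorem sum {α : Type*} (s : Finset α) {f : α → ℝ → ℝ} (hf : ∀ i ∈ s, HasExpansion (f i)) :
    HasExpansion fun h => ∑ i ∈ s, f i h := by
  classical
  induction s using Finset.induction_on with
  | empty => simpa using const 0
  | insert a s ha ih =>
    simp only [Finset.sum_insert ha]
    exact (hf a (by simp)).add (ih fun i hi => hf i (by simp [hi]))

theorem prod {α : Type*} (s : Finset α) {f : α → ℝ → ℝ} (hf : ∀ i ∈ s, HasExpansion (f i)) :
    HasExpansion fun h => ∏ i ∈ s, f i h := by
  classical
  induction s using Finset.induction_on with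
  | empty => simpa using const 1
  | insert a s ha ih =>
    simp only [Finset.prod_insert ha]
    exact (hf a (by simp)).mul (ih fun i hi => hf i (by simp [hi]))

theorem tendsto (hf : HasExpansion f) : Tendsto f (𝓝[≥] 0) (𝓝 (f 0)) := by
  obtain ⟨P, hP⟩ := hf 1
  have h0 : f 0 - P.eval 0 = 0 := eq_zero_of_isBigO_pow_succ (n := 0) (by simpa using hP)
  have h1 : Tendsto (fun h => f h - P.eval h) (𝓝[≥] 0) (𝓝 0) :=
    (hP.congr_right fun h => pow_one h).trans_tendsto (tendsto_id.mono_left nhdsWithin_le_nhds)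
  have h2 : Tendsto (fun h => P.eval h) (𝓝[≥] 0) (𝓝 (P.eval 0)) :=
    P.continuous.continuousAt.tendsto.mono_left nhdsWithin_le_nhds
  rw [sub_eq_zero.1 h0]
  simpa using h1.add h2

theorem inv (hf : HasExpansion f) (h0 : f 0 ≠ 0) : HasExpansion fun h => (f h)⁻¹ := fun n => by
  obtain ⟨P, hP⟩ := hf (n + 1)
  have hP0 : P.eval 0 ≠ 0 := by
    have h1 : f 0 - P.eval 0 = 0 := eq_zero_of_isBigO_pow_succ hP
    rwa [← sub_eq_zero.1 h1]
  have hcop : IsCoprime P (Polynomial.X ^ n) := by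
    refine IsCoprime.pow_right (IsCoprime.symm ?_)
    rw [Polynomial.irreducible_X.coprime_iff_not_dvd, Polynomial.X_dvd_iff,
      Polynomial.coeff_zero_eq_eval_zero]
    exact hP0
  obtain ⟨Q, R, hQR⟩ := hcop
  refine ⟨Q, ?_⟩
  have h1 : (fun h => 1 - f h * Q.eval h) =O[𝓝[≥] 0] fun h => h ^ n := by
    have h2 := Polynomial.isBigO_pow_of_X_pow_dvd (P := R * Polynomial.X ^ n)
      (Dvd.intro_left _ rfl) (𝓝[≥] 0) nhdsWithin_le_nhds
    have h3 := (hP.trans (isBigO_pow_of_le n.le_succ nhdsWithin_le_nhds)).mul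
      (Q.isBigO_one_nhds (𝓝[≥] 0) nhdsWithin_le_nhds)
    simp only [mul_one] at h3
    refine (h2.sub h3).congr_left fun h => ?_
    have := congrArg (Polynomial.eval h) hQR
    simp only [Polynomial.eval_add, Polynomial.eval_mul, Polynomial.eval_one] at this ⊢
    linear_combination this
  have h4 := h1.mul ((hf.tendsto.inv₀ h0).isBigO_one ℝ)
  simp only [mul_one] at h4
  refine h4.congr' ?_ EventuallyEq.rfl
  filter_upwards [hf.tendsto.eventually_ne h0] with h hh
  field_simp

theorem det {ι : Type*} [Fintype ι] [DecidableEq ι] {A : ℝ → Matrix ι ι ℝ}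
    (hA : ∀ i j, HasExpansion fun h => A h i j) : HasExpansion fun h => (A h).det := by
  simp only [det_apply']
  exact sum _ fun s _ => (const _).mul (prod _ fun i _ => hA _ _)

theorem matrix_mul {ι κ τ : Type*} [Fintype κ] {A : ℝ → Matrix ι κ ℝ} {B : ℝ → Matrix κ τ ℝ}
    (hA : ∀ i j, HasExpansion fun h => A h i j) (hB : ∀ i j, HasExpansion fun h => B h i j)
    (i : ι) (j : τ) : HasExpansion fun h => (A h * B h) i j := by
  simp only [Matrix.mul_apply]
  exact sum _ fun k _ => (hA _ _).mul (hB _ _)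

theorem matrix_inv {ι : Type*} [Fintype ι] [DecidableEq ι] {A : ℝ → Matrix ι ι ℝ}
    (hA : ∀ i j, HasExpansion fun h => A h i j) (h0 : (A 0).det ≠ 0) (i j : ι) :
    HasExpansion fun h => (A h)⁻¹ i j := by
  simp only [Matrix.inv_def, Matrix.smul_apply, smul_eq_mul, Ring.inverse_eq_inv',
    adjugate_apply]
  refine ((det hA).inv h0).mul (det fun k l => ?_)
  rcases eq_or_ne k j with rfl | hk
  · simpa using const _
  · simpa [updateRow_ne hk] using hA k l

theorem exists_coeff (hf : HasExpansion f) : ∃ a : ℕ → ℝ, a 0 = f 0 ∧ ∀ n : ℕ,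
    (fun h => f h - ∑ k ∈ Finset.range (n + 1), h ^ k * a k) =O[𝓝[≥] 0] fun h => h ^ (n + 1) := by
  choose P hP using fun n => hf (n + 1)
  have key : ∀ m n, m ≤ n → (P m).coeff m = (P n).coeff m := fun m n hmn => by
    have h1 := (hP m).sub ((hP n).trans (isBigO_pow_of_le (Nat.succ_le_succ hmn)
      nhdsWithin_le_nhds))
    have h2 : Polynomial.X ^ (m + 1) ∣ P n - P m := by
      refine Polynomial.X_pow_dvd_of_isBigO
        ((h1.congr_left fun h => ?_).mono (nhdsWithin_mono 0 Set.Ioi_subset_Ici_self))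
      rw [Polynomial.eval_sub]; ring
    have := Polynomial.X_pow_dvd_iff.1 h2 m m.lt_succ_self
    rw [Polynomial.coeff_sub] at this
    linarith
  refine ⟨fun n => (P n).coeff n, ?_, fun n => ?_⟩
  · have h1 : f 0 - (P 0).eval 0 = 0 := eq_zero_of_isBigO_pow_succ (hP 0)
    simp only [Polynomial.coeff_zero_eq_eval_zero]
    linarith
  · have h3 : Polynomial.X ^ (n + 1) ∣
        P n - ∑ k ∈ Finset.range (n + 1), Polynomial.X ^ k * Polynomial.C ((P k).coeff k) := by
      refine Polynomial.X_pow_dvd_iff.2 fun d hd => ?_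
      simp only [Polynomial.coeff_sub, Polynomial.finsetSum_coeff, Polynomial.coeff_mul_C,
        Polynomial.coeff_X_pow]
      simp [hd, key d n (Nat.lt_succ_iff.1 hd)]
    refine ((hP n).add (Polynomial.isBigO_pow_of_X_pow_dvd h3 _ nhdsWithin_le_nhds)).congr_left
      fun h => ?_
    simp only [Polynomial.eval_sub, Polynomial.eval_finsetSum, Polynomial.eval_mul,
      Polynomial.eval_pow, Polynomial.eval_X, Polynomial.eval_C]
    ring

/-- The asymptotic expansion of a function bounded on `(0, h₁]` is uniform there. -/
theorem exists_coeff_Ioc (hf : HasExpansion f) {h₁ M : ℝ}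
    (hM : ∀ h ∈ Set.Ioc 0 h₁, |f h| ≤ M) : ∃ a : ℕ → ℝ, a 0 = f 0 ∧ ∀ n : ℕ,
    ∃ C > (0 : ℝ), ∀ h ∈ Set.Ioc (0 : ℝ) h₁,
      |f h - ∑ k ∈ Finset.range (n + 1), h ^ k * a k| ≤ C * h ^ (n + 1) := by
  obtain ⟨a, ha0, ha⟩ := hf.exists_coeff
  refine ⟨a, ha0, fun n => ?_⟩
  obtain ⟨C, hC, hCb⟩ := (ha n).exists_pos
  obtain ⟨δ, hδ, hδb⟩ := (nhdsGE_basis (0 : ℝ)).eventually_iff.1 hCb.bound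
  obtain ⟨K, hK⟩ := (isCompact_Icc (a := (0 : ℝ)) (b := h₁)).exists_bound_of_continuousOn
    (f := fun h : ℝ => ∑ k ∈ Finset.range (n + 1), h ^ k * a k) (by fun_prop)
  refine ⟨C + (|M| + |K|) / δ ^ (n + 1), by positivity, fun h hh => ?_⟩
  have hh0 : 0 < h := hh.1
  rw [add_mul]
  rcases lt_or_ge h δ with hd | hd
  · have := hδb ⟨hh0.le, hd⟩
    rw [Real.norm_eq_abs, Real.norm_of_nonneg (by positivity)] at this
    have h2 : 0 ≤ (|M| + |K|) / δ ^ (n + 1) * h ^ (n + 1) := by positivity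
    linarith
  · have h1 : |f h - ∑ k ∈ Finset.range (n + 1), h ^ k * a k| ≤ |M| + |K| := by
      refine (abs_sub _ _).trans (add_le_add ((hM h hh).trans (le_abs_self M))
        ((hK h ⟨hh0.le, hh.2⟩).trans (le_abs_self K)))
    have h2 : (|M| + |K|) ≤ (|M| + |K|) / δ ^ (n + 1) * h ^ (n + 1) := by
      rw [div_mul_eq_mul_div, le_div_iff₀ (by positivity)]
      exact mul_le_mul_of_nonneg_left (pow_le_pow_left₀ hδ.le hd _) (by positivity)
    have h3 : 0 ≤ C * h ^ (n + 1) := by positivity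
    linarith

end HasExpansion

end Expansion

section SymmetricFamily

open Filter Topology Asymptotics

theorem Polynomial.exists_eventually_sign_eval_eq (p : Polynomial ℝ) :
    ∃ s : SignType, ∀ᶠ h in 𝓝[>] (0 : ℝ), SignType.sign (p.eval h) = s := by
  rcases eq_or_ne p 0 with rfl | hp
  · exact ⟨0, by simp⟩
  obtain ⟨q, hpq, hq⟩ := p.exists_eq_pow_rootMultiplicity_mul_and_not_dvd hp 0
  rw [Polynomial.dvd_iff_isRoot, Polynomial.IsRoot.def] at hq
  have hpow : ∀ h : ℝ, 0 < h → SignType.sign (p.eval h) = SignType.sign (q.eval h) := fun h hh => by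
    rw [hpq]
    simp [sign_mul, sign_pos hh, sign_pow]
  have ht : Tendsto (fun h => q.eval h) (𝓝[>] 0) (𝓝 (q.eval 0)) :=
    q.continuous.continuousAt.tendsto.mono_left nhdsWithin_le_nhds
  rcases lt_or_gt_of_ne hq with h0 | h0
  · refine ⟨-1, ?_⟩
    filter_upwards [ht.eventually_lt_const h0, self_mem_nhdsWithin] with h hh hh0
    rw [hpow h hh0, sign_neg hh]
  · refine ⟨1, ?_⟩
    filter_upwards [ht.eventually_const_lt h0, self_mem_nhdsWithin] with h hh hh0
    rw [hpow h hh0, sign_pos hh]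

theorem exists_equiv_monotone_comp {κ : Type*} {d : ℕ} (e : Fin d ≃ κ) (b : κ → ℝ) :
    ∃ σ : Fin d ≃ κ, Monotone (b ∘ σ) :=
  ⟨(Tuple.sort (b ∘ e)).trans e, Tuple.monotone_sort (b ∘ e)⟩

/-- Finitely many polynomials are totally ordered near `0⁺`. -/
theorem Polynomial.exists_equiv_eventually_monotone {κ : Type*} [Finite κ] {d : ℕ} (e : Fin d ≃ κ)
    (b : κ → Polynomial ℝ) :
    ∃ σ : Fin d ≃ κ, ∀ᶠ h in 𝓝[≥] (0 : ℝ), Monotone ((fun i => (b i).eval h) ∘ σ) := by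
  choose s hs using fun i j => (b i - b j).exists_eventually_sign_eval_eq
  have hs' : ∀ᶠ h in 𝓝[>] (0 : ℝ), ∀ i j, SignType.sign ((b i - b j).eval h) = s i j :=
    eventually_all.2 fun i => eventually_all.2 fun j => hs i j
  obtain ⟨h', hh'⟩ := hs'.exists
  obtain ⟨σ, hσ⟩ := exists_equiv_monotone_comp e fun i => (b i).eval h'
  have hpos : ∀ᶠ h in 𝓝[>] (0 : ℝ), Monotone ((fun i => (b i).eval h) ∘ σ) := by
    filter_upwards [hs'] with h hh k l hkl
    have h1 := hσ hkl
    simp only [Function.comp_apply] at h1 ⊢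
    rw [← sub_nonneg, ← Polynomial.eval_sub, ← sign_nonneg_iff] at h1 ⊢
    rwa [hh, ← hh']
  have hzero : Monotone ((fun i => (b i).eval 0) ∘ σ) := fun k l hkl =>
    le_of_tendsto_of_tendsto
      ((b (σ k)).continuous.continuousAt.tendsto.mono_left nhdsWithin_le_nhds)
      ((b (σ l)).continuous.continuousAt.tendsto.mono_left nhdsWithin_le_nhds)
      (hpos.mono fun h hh => hh hkl)
  refine ⟨σ, ?_⟩
  rw [← Set.Ioi_insert, nhdsWithin_insert, eventually_sup]
  exact ⟨by simpa using hzero, hpos⟩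

variable {ι : Type*} [Fintype ι] [DecidableEq ι]

theorem Polynomial.exists_approx_diagonalization {A : Matrix ι ι (Polynomial ℝ)} (hA : Aᵀ = A)
    (n : ℕ) : ∃ (U : Matrix ι ι (Polynomial ℝ)) (b : ι → Polynomial ℝ),
      (∀ i j, Polynomial.X ^ n ∣ (U * Uᵀ - 1 : Matrix ι ι (Polynomial ℝ)) i j) ∧
      ∀ i j, Polynomial.X ^ n ∣ (A - U * diagonal b * Uᵀ : Matrix ι ι (Polynomial ℝ)) i j := by
  let φ : Polynomial ℝ →+* PowerSeries ℝ := Polynomial.coeToPowerSeries.ringHom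
  obtain ⟨U, hU, hUA⟩ := exists_orthogonal_offDiag_X_pow_dvd (A := φ.mapMatrix A)
    (by conv_rhs => rw [← hA]
        rfl) n
  let π := Ideal.Quotient.mk (Ideal.span {(PowerSeries.X ^ n : PowerSeries ℝ)})
  have hπ : ∀ x, π x = 0 ↔ PowerSeries.X ^ n ∣ x := fun x => by
    rw [Ideal.Quotient.eq_zero_iff_mem, Ideal.mem_span_singleton]
  let ψ := π.comp φ
  have hψ : ∀ p, ψ p = 0 ↔ Polynomial.X ^ n ∣ p := fun p => by
    rw [RingHom.comp_apply, hπ, Polynomial.X_pow_dvd_iff, PowerSeries.X_pow_dvd_iff]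
    simp [φ]
  have htrunc : ∀ f : PowerSeries ℝ, ψ (f.trunc n) = π f := fun f => by
    rw [← sub_eq_zero, RingHom.comp_apply, ← map_sub, hπ, PowerSeries.X_pow_dvd_iff]
    intro m hm
    simp [φ, PowerSeries.coeff_trunc, hm]
  let V : Matrix ι ι (Polynomial ℝ) := of fun i j => (U i j).trunc n
  let b : ι → Polynomial ℝ := fun i => ((Uᵀ * φ.mapMatrix A * U) i i).trunc n
  have hV : ψ.mapMatrix V = π.mapMatrix U := by ext i j; simp [V, htrunc]
  have hVt : ψ.mapMatrix Vᵀ = π.mapMatrix Uᵀ := by ext i j; simp [V, htrunc]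
  have hb : ψ.mapMatrix (diagonal b) = π.mapMatrix (Uᵀ * φ.mapMatrix A * U) := by
    ext i j
    rcases eq_or_ne i j with rfl | hij
    · simp only [RingHom.mapMatrix_apply, map_apply, diagonal_apply_eq, b, htrunc]
    · simp only [RingHom.mapMatrix_apply, map_apply, diagonal_apply_ne _ hij, map_zero]
      exact ((hπ _).2 (hUA i j hij)).symm
  have hAπ : ψ.mapMatrix A = π.mapMatrix (φ.mapMatrix A) := rfl
  have key : ∀ {B : Matrix ι ι (Polynomial ℝ)}, ψ.mapMatrix B = 0 →
      ∀ i j, Polynomial.X ^ n ∣ B i j := fun {B} hB i j =>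
    (hψ _).1 (congrFun (congrFun hB i) j)
  refine ⟨V, b, key ?_, key ?_⟩
  · rw [map_sub, map_mul, hV, hVt, ← map_mul, hU, map_one, map_one, sub_self]
  · rw [map_sub, map_mul, map_mul, hV, hVt, hb, hAπ, ← map_mul, ← map_mul, ← map_sub]
    have : U * (Uᵀ * φ.mapMatrix A * U) * Uᵀ = φ.mapMatrix A := by
      simp only [Matrix.mul_assoc, hU, Matrix.mul_one]
      rw [← Matrix.mul_assoc, hU, Matrix.one_mul]
    rw [this, sub_self, map_zero]

/-- The ordered eigenvalues of a family of symmetric matrices with classical expansion have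
classical expansions. -/
theorem HasExpansion.eigenvalue {d : ℕ} (hd : Fintype.card ι = d) {A : ℝ → Matrix ι ι ℝ}
    (hA : ∀ i j, HasExpansion fun h => A h i j) (hs : ∀ h, (A h)ᵀ = A h)
    {V : ℝ → Matrix ι (Fin d) ℝ} {a : ℝ → Fin d → ℝ}
    (ha : ∀ h, IsSortedSpectrum (A h) (V h) (a h)) (k : Fin d) :
    HasExpansion fun h => a h k := fun n => by
  choose P hP using fun i j => hA i j n
  let B : Matrix ι ι (Polynomial ℝ) := of fun i j => Polynomial.C (1 / 2) * (P i j + P j i)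
  have hB : ∀ i j, (fun h => A h i j - (B i j).eval h) =O[𝓝[≥] 0] fun h => h ^ n := fun i j => by
    refine (((hP i j).add (hP j i)).const_mul_left (1 / 2)).congr_left fun h => ?_
    have : A h j i = A h i j := congrFun (congrFun (hs h) i) j
    simp only [B, of_apply, this, Polynomial.eval_mul, Polynomial.eval_C, Polynomial.eval_add]
    ring
  obtain ⟨U, b, hU, hUB⟩ := Polynomial.exists_approx_diagonalization (A := B)
    (by ext1 i j; simp [B, add_comm]) n
  obtain ⟨σ, hσ⟩ :=
    Polynomial.exists_equiv_eventually_monotone (Fintype.equivFinOfCardEq hd).symm b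
  let Z : ℝ → Matrix ι ι ℝ := fun h => (Polynomial.evalRingHom h).mapMatrix U
  let β : ℝ → ι → ℝ := fun h i => (b i).eval h
  have hZ : ∀ i j, (fun h => (Z h * (Z h)ᵀ - 1 : Matrix ι ι ℝ) i j) =O[𝓝[≥] 0] fun h => h ^ n :=
    fun i j => by
      refine (Polynomial.isBigO_pow_of_X_pow_dvd (hU i j) _ nhdsWithin_le_nhds).congr_left
        fun h => ?_
      have : Z h * (Z h)ᵀ - 1 = (Polynomial.evalRingHom h).mapMatrix (U * Uᵀ - 1) := by
        rw [map_sub, map_mul, map_one]; rfl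
      rw [this]; rfl
  have hAZ : ∀ i j, (fun h => (A h - Z h * diagonal (β h) * (Z h)ᵀ : Matrix ι ι ℝ) i j)
      =O[𝓝[≥] 0] fun h => h ^ n := fun i j => by
    refine ((hB i j).add (Polynomial.isBigO_pow_of_X_pow_dvd (hUB i j) _
      nhdsWithin_le_nhds)).congr_left fun h => ?_
    have h1 : diagonal (β h) = (Polynomial.evalRingHom h).mapMatrix (diagonal b) := by
      simp [β, diagonal_map]
    have h2 : Z h * diagonal (β h) * (Z h)ᵀ =
        (Polynomial.evalRingHom h).mapMatrix (U * diagonal b * Uᵀ) := by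
      rw [map_mul, map_mul, h1]; rfl
    rw [h2]
    simp [Matrix.sub_apply]
  have hZ' := IsBigO.sum (s := Finset.univ) (l := 𝓝[≥] (0 : ℝ)) fun (i : ι × ι) _ =>
    (hZ i.1 i.2).norm_left
  have hAZ' := IsBigO.sum (s := Finset.univ) (l := 𝓝[≥] (0 : ℝ)) fun (i : ι × ι) _ =>
    (hAZ i.1 i.2).norm_left
  refine ⟨b (σ k), ?_⟩
  have h3 := ((hZ'.const_mul_left (Fintype.card ι : ℝ)).mul
    ((b (σ k)).isBigO_one_nhds (𝓝[≥] 0) nhdsWithin_le_nhds).norm_left).add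
    ((hAZ'.const_mul_left (Fintype.card ι : ℝ)).congr_right fun h => (mul_one _).symm)
  refine (IsBigO.trans (IsBigO.of_norm_eventuallyLE ?_) h3).congr_right fun h => mul_one _
  filter_upwards [hσ] with h hh
  have hle : ∀ (F : ι → ι → ℝ) (i j : ι), |F i j| ≤ ∑ l : ι × ι, |F l.1 l.2| := fun F i j =>
    Finset.single_le_sum (f := fun l : ι × ι => |F l.1 l.2|) (fun _ _ => abs_nonneg _)
      (Finset.mem_univ (i, j))
  simp only [Finset.sum_apply, Real.norm_eq_abs]
  exact (ha h).abs_sub_le hd (Z h) (β h) σ hh (hle _) (hle _) k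

end SymmetricFamily

section SchurComplements

open Filter Topology

variable {p : ℕ} {r : Fin p → ℕ}

theorem IsSortedSpectrum.pos {ι : Type*} [Fintype ι] [DecidableEq ι] {d : ℕ} {A : Matrix ι ι ℝ}
    {V : Matrix ι (Fin d) ℝ} {a : Fin d → ℝ} (h : IsSortedSpectrum A V a)
    (hd : Fintype.card ι = d) (hA : A.PosDef) (k : Fin d) : 0 < a k := by
  have hk : a k ∈ A.charpoly.roots := by
    rw [h.roots_charpoly hd]
    exact Multiset.mem_map_of_mem a (Finset.mem_univ k)
  rw [hA.1.roots_charpoly_eq_eigenvalues, Multiset.mem_map] at hk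
  obtain ⟨i, -, hi⟩ := hk
  rw [← hi]
  exact hA.eigenvalues_pos i

theorem transpose_schurStep {k : ℕ} {A : Matrix (TailIdx p r k) (TailIdx p r k) ℝ} (hA : Aᵀ = A) :
    (schurStep p r k A)ᵀ = schurStep p r k A := by
  simp only [schurStep, transpose_sub, transpose_mul, transpose_submatrix, transpose_nonsing_inv,
    hA, Matrix.mul_assoc]

theorem transpose_schurIter {A : Matrix (BlockIdx p r) (BlockIdx p r) ℝ} (hA : Aᵀ = A) (k : ℕ) :
    (schurIter p r A k)ᵀ = schurIter p r A k := by
  induction k with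
  | zero => rw [schurIter, transpose_submatrix, hA]
  | succ k ih => exact transpose_schurStep ih

theorem transpose_schurBlock {A : Matrix (BlockIdx p r) (BlockIdx p r) ℝ} (hA : Aᵀ = A) (k : ℕ) :
    (schurBlock p r A k)ᵀ = schurBlock p r A k := by
  rw [schurBlock, transpose_submatrix, transpose_schurIter hA]

theorem posDef_schurStep {k : ℕ} {A : Matrix (TailIdx p r k) (TailIdx p r k) ℝ} (hA : A.PosDef) :
    (schurStep p r k A).PosDef := by
  let e₂ : TailIdx p r (k + 1) → TailIdx p r k := fun i => ⟨i.1, (Nat.le_succ k).trans i.2⟩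
  let e₁ : BlkIdx p r k → TailIdx p r k := fun i => ⟨i.1, i.2.ge⟩
  have he : Function.Injective (Sum.elim e₁ e₂) := by
    refine Function.Injective.sumElim (fun i j h => ?_) (fun i j h => ?_) fun i j h => ?_
    · exact Subtype.ext (congrArg (fun l => l.1) h)
    · exact Subtype.ext (congrArg (fun l => l.1) h)
    · have h1 : i.1 = j.1 := congrArg (fun l => l.1) h
      have h2 := i.2
      have h3 := j.2
      rw [h1] at h2
      lia
  have hJ : IsUnit (A.submatrix e₁ e₁) :=
    (hA.submatrix (he.comp Sum.inl_injective)).isUnit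
  have hdet := (isUnit_iff_isUnit_det _).1 hJ
  have hB := hA.submatrix he
  have hblock : A.submatrix (Sum.elim e₁ e₂) (Sum.elim e₁ e₂) =
      fromBlocks (A.submatrix e₁ e₁) (A.submatrix e₁ e₂) (A.submatrix e₂ e₁)
        (A.submatrix e₂ e₂) := by
    ext (i | i) (j | j) <;> rfl
  have hAt : Aᵀ = A := by
    rw [← conjTranspose_eq_transpose_of_trivial]; exact hA.1
  let P : Matrix (BlkIdx p r k ⊕ TailIdx p r (k + 1)) (TailIdx p r (k + 1)) ℝ :=
    fromRows (-((A.submatrix e₁ e₁)⁻¹ * A.submatrix e₁ e₂)) 1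
  have hP : Function.Injective P.mulVec := fun x y hxy => by
    funext i
    have := congrFun hxy (Sum.inr i)
    simpa [P, fromRows_mulVec] using this
  have := hB.conjTranspose_mul_mul_same hP
  convert this using 1
  rw [hblock, conjTranspose_eq_transpose_of_trivial, transpose_fromRows, fromCols_mul_fromBlocks,
    fromCols_mul_fromRows]
  simp only [transpose_neg, transpose_mul, transpose_submatrix, transpose_nonsing_inv, hAt,
    transpose_one, Matrix.neg_mul, Matrix.mul_assoc, nonsing_inv_mul _ hdet, Matrix.mul_one,
    Matrix.one_mul, neg_add_cancel, Matrix.zero_mul, zero_add]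
  simp only [schurStep, ← Matrix.mul_assoc]
  exact (neg_add_eq_sub _ _).symm

theorem posDef_schurIter {A : Matrix (BlockIdx p r) (BlockIdx p r) ℝ} (hA : A.PosDef) (k : ℕ) :
    (schurIter p r A k).PosDef := by
  induction k with
  | zero => exact hA.submatrix Subtype.val_injective
  | succ k ih => exact posDef_schurStep ih

theorem posDef_schurBlock {A : Matrix (BlockIdx p r) (BlockIdx p r) ℝ} (hA : A.PosDef) (k : ℕ) :
    (schurBlock p r A k).PosDef :=
  (posDef_schurIter hA k).submatrix fun _ _ h =>
    Subtype.ext (congrArg (fun l : TailIdx p r k => l.1) h)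

theorem HasExpansion.schurIter {A : ℝ → Matrix (BlockIdx p r) (BlockIdx p r) ℝ}
    (hA : ∀ i j, HasExpansion fun h => A h i j) (h0 : (A 0).PosDef) (k : ℕ) (i j) :
    HasExpansion fun h => schurIter p r (A h) k i j := by
  induction k with
  | zero => exact hA _ _
  | succ k ih =>
    exact (ih _ _).sub (matrix_mul (matrix_mul (fun _ _ => ih _ _)
      (matrix_inv (A := fun h => schurBlock p r (A h) k) (fun _ _ => ih _ _)
        (posDef_schurBlock h0 k).det_pos.ne')) (fun _ _ => ih _ _) i j)

/-- The columns of the iterated Schur complement `S⁽ᵏ⁾` in its first block, extended by zero. -/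
def schurCols (p : ℕ) (r : Fin p → ℕ) (A : Matrix (BlockIdx p r) (BlockIdx p r) ℝ) (k : ℕ) :
    Matrix (BlockIdx p r) (BlkIdx p r k) ℝ :=
  of fun i l => if h : k ≤ (i.1 : ℕ) then schurIter p r A k ⟨i, h⟩ ⟨l.1, l.2.ge⟩ else 0

/-- The columns of the block `k` of the unit lower triangular factor of the block `LDLᵀ`
decomposition of `A`. -/
def schurFactor (p : ℕ) (r : Fin p → ℕ) (A : Matrix (BlockIdx p r) (BlockIdx p r) ℝ) (k : ℕ) :
    Matrix (BlockIdx p r) (BlkIdx p r k) ℝ :=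
  schurCols p r A k * (schurBlock p r A k)⁻¹

theorem HasExpansion.schurFactor {A : ℝ → Matrix (BlockIdx p r) (BlockIdx p r) ℝ}
    (hA : ∀ i j, HasExpansion fun h => A h i j) (h0 : (A 0).PosDef) (k : ℕ) (i j) :
    HasExpansion fun h => schurFactor p r (A h) k i j := by
  refine matrix_mul (fun i l => ?_)
      (matrix_inv (A := fun h => schurBlock p r (A h) k) (fun _ _ => .schurIter hA h0 k _ _)
        (posDef_schurBlock h0 k).det_pos.ne') i j
  simp only [schurCols, of_apply]
  split_ifs
  · exact .schurIter hA h0 k _ _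
  · exact const 0

theorem schurFactor_of_lt (A : Matrix (BlockIdx p r) (BlockIdx p r) ℝ) {k : ℕ} {i : BlockIdx p r}
    (hi : (i.1 : ℕ) < k) (l : BlkIdx p r k) : schurFactor p r A k i l = 0 := by
  rw [schurFactor, Matrix.mul_apply]
  simp [schurCols, hi.not_ge]

theorem schurFactor_of_eq {A : Matrix (BlockIdx p r) (BlockIdx p r) ℝ} {k : ℕ}
    (hA : IsUnit (schurBlock p r A k).det) (i l : BlkIdx p r k) :
    schurFactor p r A k i.1 l = (1 : Matrix _ _ ℝ) i l := by
  rw [← mul_nonsing_inv _ hA, schurFactor, Matrix.mul_apply, Matrix.mul_apply]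
  simp [schurCols, i.2.ge, schurBlock]

/-- The iterated Schur complement, extended by zero to all indices. -/
def schurExt (p : ℕ) (r : Fin p → ℕ) (A : Matrix (BlockIdx p r) (BlockIdx p r) ℝ) (k : ℕ) :
    Matrix (BlockIdx p r) (BlockIdx p r) ℝ :=
  of fun i j => if h : k ≤ (i.1 : ℕ) ∧ k ≤ (j.1 : ℕ) then
    schurIter p r A k ⟨i, h.1⟩ ⟨j, h.2⟩ else 0

theorem schurExt_sub_schurExt_succ {A : Matrix (BlockIdx p r) (BlockIdx p r) ℝ} (hs : Aᵀ = A)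
    {k : ℕ} (hA : IsUnit (schurBlock p r A k).det) :
    schurExt p r A k - schurExt p r A (k + 1) =
      schurFactor p r A k * schurBlock p r A k * (schurFactor p r A k)ᵀ := by
  have hsym : ∀ i j, schurIter p r A k i j = schurIter p r A k j i := fun i j =>
    congrFun (congrFun (transpose_schurIter hs k) j) i
  have h1 : schurFactor p r A k * schurBlock p r A k * (schurFactor p r A k)ᵀ =
      schurFactor p r A k * (schurCols p r A k)ᵀ := by
    rw [schurFactor, transpose_mul, transpose_nonsing_inv, transpose_schurBlock hs,
      Matrix.mul_assoc (schurCols p r A k), nonsing_inv_mul _ hA, Matrix.mul_one, Matrix.mul_assoc]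
  rw [h1]
  ext i j
  rw [Matrix.sub_apply]
  rcases lt_trichotomy (i.1 : ℕ) k with hi | hi | hi
  · rw [Matrix.mul_apply, Finset.sum_eq_zero fun l _ => by rw [schurFactor_of_lt A hi, zero_mul]]
    simp [schurExt, hi.not_ge, hi.not_gt]
  · rw [Matrix.mul_apply]
    let i' : BlkIdx p r k := ⟨i, hi⟩
    have : ∀ l, schurFactor p r A k i l = (1 : Matrix _ _ ℝ) i' l := schurFactor_of_eq hA i'
    simp only [this, transpose_apply]
    simp only [schurExt, of_apply, schurCols, hi, le_refl, true_and, hsym _ ⟨j, _⟩]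
    simp [Matrix.one_apply, i']
  rcases lt_trichotomy (j.1 : ℕ) k with hj | hj | hj
  · have : ∀ l, (schurCols p r A k)ᵀ l j = 0 := fun l => by simp [schurCols, hj.not_ge]
    rw [Matrix.mul_apply, Finset.sum_eq_zero fun l _ => by rw [this, mul_zero]]
    simp [schurExt, hj.not_ge, hj.not_gt]
  · have h2 : ∀ l, (schurCols p r A k)ᵀ l j = schurBlock p r A k l ⟨j, hj⟩ := fun l => by
      simp [schurCols, hj.ge, schurBlock, hsym ⟨j, _⟩]
    rw [Matrix.mul_apply]
    simp only [h2, ← Matrix.mul_apply]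
    rw [schurFactor, Matrix.mul_assoc, nonsing_inv_mul _ hA, Matrix.mul_one]
    simp [schurExt, schurCols, hi.le, hj]
  · have h3 : schurExt p r A (k + 1) i j = schurStep p r k (schurIter p r A k) ⟨i, hi⟩ ⟨j, hj⟩ := by
      simp only [schurExt, of_apply]
      rw [dif_pos ⟨hi, hj⟩]
      rfl
    rw [h3]
    simp only [schurExt, of_apply]
    rw [dif_pos ⟨hi.le, hj.le⟩]
    simp only [schurStep, Matrix.sub_apply, submatrix_apply, sub_sub_cancel]
    rw [schurFactor, Matrix.mul_apply, Matrix.mul_apply]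
    refine Finset.sum_congr rfl fun l _ => ?_
    rw [Matrix.mul_apply, Matrix.mul_apply]
    simp only [of_apply, transpose_apply, schurCols, hi.le, hj.le, dif_pos, submatrix_apply,
      hsym ⟨j, _⟩]
    rfl

theorem eq_sum_schurFactor {A : Matrix (BlockIdx p r) (BlockIdx p r) ℝ} (hs : Aᵀ = A)
    (hA : ∀ k : Fin p, IsUnit (schurBlock p r A k).det) :
    A = ∑ k : Fin p, schurFactor p r A k * schurBlock p r A k * (schurFactor p r A k)ᵀ := by
  have h1 : ∀ k : Fin p, schurFactor p r A k * schurBlock p r A k * (schurFactor p r A k)ᵀ =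
      schurExt p r A k - schurExt p r A (k + 1) := fun k =>
    (schurExt_sub_schurExt_succ hs (hA k)).symm
  simp only [h1]
  rw [Fin.sum_univ_eq_sum_range fun k => schurExt p r A k - schurExt p r A (k + 1),
    Finset.sum_range_sub']
  ext i j
  simp [schurExt, schurIter, i.1.2.not_ge]

end SchurComplements

section GradedGram

open Filter Topology Asymptotics

variable {p : ℕ} {r : Fin p → ℕ}

theorem card_blkIdx (p : ℕ) (r : Fin p → ℕ) (j : Fin p) : Fintype.card (BlkIdx p r j) = r j := by
  rw [Fintype.card_congr ((Equiv.subtypeEquivRight fun i : BlockIdx p r =>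
    (Fin.ext_iff (a := i.1) (b := j)).symm).trans (Equiv.sigmaSubtype j)), Fintype.card_fin]

theorem exists_pos_le_sub_of_strictMono {α : Type*} [Finite α] [Preorder α] {S : α → ℝ}
    (hS : StrictMono S) : ∃ c > (0 : ℝ), ∀ i j, i < j → c ≤ S j - S i := by
  have h1 : ∀ᶠ c in 𝓝[>] (0 : ℝ), ∀ i j, i < j → c ≤ S j - S i := by
    refine eventually_all.2 fun i => eventually_all.2 fun j => ?_
    by_cases hij : i < j
    · filter_upwards [(eventually_le_nhds (sub_pos.2 (hS hij))).filter_mono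
        nhdsWithin_le_nhds] with c hc _ using hc
    · exact Eventually.of_forall fun c h => absurd h hij
  obtain ⟨c, hc, hc0⟩ := (h1.and self_mem_nhdsWithin).exists
  exact ⟨c, hc0, hc⟩

theorem HasExpansion.exists_bound {κ : Type*} [Fintype κ] {f : κ → ℝ → ℝ}
    (hf : ∀ i, HasExpansion (f i)) : ∃ B ≥ (0 : ℝ), ∀ᶠ h in 𝓝[≥] 0, ∀ i, |f i h| ≤ B := by
  choose C hC using fun i => (hf i).isBigO_one.bound
  refine ⟨∑ i, |C i|, Finset.sum_nonneg fun i _ => abs_nonneg _, eventually_all.2 fun i => ?_⟩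
  filter_upwards [hC i] with h hh
  rw [norm_one, mul_one] at hh
  exact (hh.trans (le_abs_self _)).trans
    (Finset.single_le_sum (f := fun i => |C i|) (fun _ _ => abs_nonneg _) (Finset.mem_univ i))

/-- The eigenvalues of `Ω A Ω`, for `Ω` a strongly graded diagonal matrix and
`A = ∑ⱼ Lⱼ Jⱼ Lⱼᵀ` a block `LDLᵀ` decomposition, are those of the blocks `Jⱼ`, scaled by the
square of `Ω`, up to an exponentially small relative error. -/
theorem exists_roots_graded_charpoly {A : Matrix (BlockIdx p r) (BlockIdx p r) ℝ} (hA : Aᵀ = A)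
    {L : (j : Fin p) → Matrix (BlockIdx p r) (BlkIdx p r j) ℝ}
    {J : (j : Fin p) → Matrix (BlkIdx p r j) (BlkIdx p r j) ℝ}
    (hAL : A = ∑ j, L j * J j * (L j)ᵀ)
    (hL0 : ∀ (j : Fin p) (i : BlockIdx p r), i.1 < j → ∀ l, L j i l = 0)
    (hL1 : ∀ (j : Fin p) (i l : BlkIdx p r j), L j i.1 l = (1 : Matrix _ _ ℝ) i l)
    {V : (j : Fin p) → Matrix (BlkIdx p r j) (Fin (r j)) ℝ} {a : (j : Fin p) → Fin (r j) → ℝ}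
    (hV : ∀ j, IsSortedSpectrum (J j) (V j) (a j)) {S : Fin p → ℝ} (hS : StrictMono S) {c : ℝ}
    (hc : ∀ i j, i < j → c ≤ S j - S i) {B : ℝ} (hB0 : 0 ≤ B)
    (hB : ∀ j i i', |(L j * (L j)ᵀ) i i'| ≤ B) {h : ℝ} (hh : 0 < h) :
    ∃ μ : (j : Fin p) → Fin (r j) → ℝ,
      (diagonal (fun i : BlockIdx p r => Real.exp (-S i.1 / h)) * A *
          diagonal (fun i : BlockIdx p r => Real.exp (-S i.1 / h))).charpoly.roots =
        Multiset.map (fun i : BlockIdx p r => μ i.1 i.2) Finset.univ.val ∧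
      ∀ j m, |μ j m - Real.exp (-(2 * S j) / h) * a j m| ≤
        Fintype.card (BlockIdx p r) * (p * (B * Real.exp (-c / h))) *
          |Real.exp (-(2 * S j) / h) * a j m| := by
  let Ω : Matrix (BlockIdx p r) (BlockIdx p r) ℝ := diagonal fun i => Real.exp (-S i.1 / h)
  have hM : (Ω * A * Ω)ᵀ = Ω * A * Ω := by
    simp only [Ω, transpose_mul, diagonal_transpose, hA, Matrix.mul_assoc]
  obtain ⟨U, μ, hU⟩ := exists_isSortedSpectrum hM rfl
  let b : BlockIdx p r → ℝ := fun κ => Real.exp (-(2 * S κ.1) / h) * a κ.1 κ.2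
  obtain ⟨σ, hσ⟩ := exists_equiv_monotone_comp (Fintype.equivFin (BlockIdx p r)).symm b
  let Z : Matrix (BlockIdx p r) (BlockIdx p r) ℝ :=
    of fun i κ => Real.exp (-(S i.1 - S κ.1) / h) * (L κ.1 * V κ.1) i κ.2
  have hMZ : Ω * A * Ω = Z * diagonal b * Zᵀ := by
    ext i i'
    have hA' : A i i' = ∑ j, ∑ m, (L j * V j) i m * a j m * (L j * V j) i' m := by
      conv_lhs => rw [hAL]
      rw [Matrix.sum_apply]
      refine Finset.sum_congr rfl fun j _ => ?_
      have : L j * J j * (L j)ᵀ = L j * V j * diagonal (a j) * (L j * V j)ᵀ := by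
        conv_lhs => rw [(hV j).eq]
        simp only [transpose_mul, Matrix.mul_assoc]
      rw [this, Matrix.mul_apply]
      simp only [mul_diagonal, transpose_apply]
    simp only [Ω, mul_diagonal, diagonal_mul, Matrix.mul_apply (M := Z * diagonal b), hA',
      transpose_apply, Fintype.sum_sigma, Finset.mul_sum, Finset.sum_mul, Z, of_apply, b]
    refine Finset.sum_congr rfl fun j _ => Finset.sum_congr rfl fun m _ => ?_
    have e1 : Real.exp (-S i.1 / h) = Real.exp (-(S i.1 - S j) / h) * Real.exp (-S j / h) := by
      rw [← Real.exp_add]; congr 1; ring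
    have e2 : Real.exp (-S i'.1 / h) = Real.exp (-(S i'.1 - S j) / h) * Real.exp (-S j / h) := by
      rw [← Real.exp_add]; congr 1; ring
    have e3 : Real.exp (-(2 * S j) / h) = Real.exp (-S j / h) * Real.exp (-S j / h) := by
      rw [← Real.exp_add]; congr 1; ring
    rw [e1, e2, e3]
    ring
  have hZ : ∀ i i', |(Z * Zᵀ - 1 : Matrix _ _ ℝ) i i'| ≤ p * (B * Real.exp (-c / h)) := by
    intro i i'
    have e1 : (Z * Zᵀ - 1 : Matrix _ _ ℝ) i i' =
        ∑ j, (Real.exp (-(S i.1 - S j) / h) * Real.exp (-(S i'.1 - S j) / h) *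
          (L j * (L j)ᵀ) i i' - if i.1 = j then (1 : Matrix _ _ ℝ) i i' else 0) := by
      have e2 : ∀ j, L j * (L j)ᵀ = (L j * V j) * (L j * V j)ᵀ := fun j => by
        rw [transpose_mul, Matrix.mul_assoc, ← Matrix.mul_assoc (V j), (hV j).mul_transpose,
          Matrix.one_mul]
      rw [Matrix.sub_apply, Finset.sum_sub_distrib, Finset.sum_ite_eq, if_pos (Finset.mem_univ _),
        Matrix.mul_apply, Fintype.sum_sigma]
      congr 1
      refine Finset.sum_congr rfl fun j _ => ?_
      rw [e2, Matrix.mul_apply, Finset.mul_sum]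
      refine Finset.sum_congr rfl fun m _ => ?_
      simp only [Z, of_apply, transpose_apply]
      ring
    have hpos : 0 ≤ B * Real.exp (-c / h) := by positivity
    have hterm : ∀ j, |Real.exp (-(S i.1 - S j) / h) * Real.exp (-(S i'.1 - S j) / h) *
        (L j * (L j)ᵀ) i i' - if i.1 = j then (1 : Matrix _ _ ℝ) i i' else 0| ≤
          B * Real.exp (-c / h) := by
      intro j
      have hbound : S j ≤ S i.1 → S j ≤ S i'.1 → c ≤ (S i.1 - S j) + (S i'.1 - S j) →
          |Real.exp (-(S i.1 - S j) / h) * Real.exp (-(S i'.1 - S j) / h) *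
            (L j * (L j)ᵀ) i i'| ≤ B * Real.exp (-c / h) := fun _ _ h3 => by
        rw [abs_mul, ← Real.exp_add, Real.abs_exp, mul_comm]
        refine mul_le_mul (hB _ _ _) (Real.exp_le_exp.2 ?_) (Real.exp_pos _).le hB0
        rw [← add_div]
        exact div_le_div_of_nonneg_right (by linarith) hh.le
      have hne : i.1 ≠ i'.1 → (1 : Matrix (BlockIdx p r) (BlockIdx p r) ℝ) i i' = 0 := fun hn =>
        Matrix.one_apply_ne fun h => hn (by rw [h])
      rcases lt_trichotomy i.1 j with hi | hi | hi
      · have : (L j * (L j)ᵀ) i i' = 0 := by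
          rw [Matrix.mul_apply]
          exact Finset.sum_eq_zero fun l _ => by rw [hL0 j i hi, zero_mul]
        simpa [this, hi.ne] using hpos
      · rcases lt_trichotomy i'.1 j with hi' | hi' | hi'
        · have : (L j * (L j)ᵀ) i i' = 0 := by
            rw [Matrix.mul_apply]
            exact Finset.sum_eq_zero fun l _ => by
              rw [transpose_apply, hL0 j i' hi', mul_zero]
          simpa [this, hne (by rw [hi]; exact hi'.ne')] using hpos
        · have : (L j * (L j)ᵀ) i i' = (1 : Matrix _ _ ℝ) i i' := by
            rw [Matrix.mul_apply]
            let k : BlkIdx p r j := ⟨i, by rw [hi]⟩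
            let k' : BlkIdx p r j := ⟨i', by rw [hi']⟩
            have e3 : ∀ l, L j i l = (1 : Matrix _ _ ℝ) k l := hL1 j k
            have e4 : ∀ l, L j i' l = (1 : Matrix _ _ ℝ) k' l := hL1 j k'
            simp [e3, e4, Matrix.one_apply, k, k', eq_comm]
          simpa [this, hi, hi'] using hpos
        · have hs := hc j i'.1 hi'
          rw [hne (by rw [hi]; exact hi'.ne), ite_self, sub_zero]
          exact hbound (by rw [hi]) (hS hi').le (by rw [hi]; linarith)
      · rcases lt_or_ge i'.1 j with hi' | hi'
        · have : (L j * (L j)ᵀ) i i' = 0 := by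
            rw [Matrix.mul_apply]
            exact Finset.sum_eq_zero fun l _ => by
              rw [transpose_apply, hL0 j i' hi', mul_zero]
          simpa [this, hi.ne'] using hpos
        · have hs := hc j i.1 hi
          have hs' := hS.monotone hi'
          rw [if_neg hi.ne', sub_zero]
          exact hbound (hS hi).le hs' (by linarith)
    rw [e1]
    refine (Finset.abs_sum_le_sum_abs _ _).trans ((Finset.sum_le_sum fun j _ => hterm j).trans ?_)
    simp
  refine ⟨fun j m => μ (σ.symm ⟨j, m⟩), ?_, fun j m => ?_⟩
  · rw [show diagonal (fun i : BlockIdx p r => Real.exp (-S i.1 / h)) = Ω from rfl,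
      hU.roots_charpoly rfl, ← Finset.map_univ_equiv σ.symm, Finset.map_val, Multiset.map_map]
    rfl
  · have := hU.abs_sub_le rfl Z b σ hσ hZ (δ := 0) (fun i j => by rw [hMZ, sub_self]; simp)
      (σ.symm ⟨j, m⟩)
    simpa [b] using this

theorem exists_rate_pos_of_exp (K : ℝ) {c : ℝ} (hc : 0 < c) :
    ∀ᶠ h in 𝓝[>] (0 : ℝ), K * Real.exp (-c / h) ≤ Real.exp (-(c / 2) / h) := by
  have h1 : Tendsto (fun h : ℝ => K * Real.exp (-((c / 2) * h⁻¹))) (𝓝[>] 0) (𝓝 (K * 0)) :=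
    (Real.tendsto_exp_neg_atTop_nhds_zero.comp
      (tendsto_inv_nhdsGT_zero.const_mul_atTop (half_pos hc))).const_mul K
  rw [mul_zero] at h1
  filter_upwards [h1.eventually_le_const one_pos] with h hh
  have e : Real.exp (-c / h) = Real.exp (-((c / 2) * h⁻¹)) * Real.exp (-(c / 2) / h) := by
    rw [← Real.exp_add]; congr 1; ring
  rw [e, ← mul_assoc]
  exact mul_le_of_le_one_left (Real.exp_pos _).le hh

end GradedGram

open Filter Topology Asymptotics

/-- **Eyring–Kramers type asymptotics of the eigenvalues of `𝓜(h) = Ω(h) W(h)ᵀ W(h) Ω(h)`.**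
Blocks of sizes `r j ≥ 1` carry heights `0 < S 0 < S 1 < ⋯`, `Ω(h)` is diagonal with entries
`exp(−S j / h)` on block `j`, and `W(h)` is an `N × q` family with classical expansion
`W(h) ∼ Σ hᵏ Wₖ`, `W₀` injective.  Then there are `c > 0`, `h₁ > 0` and, for each block `j`
and `m < r j`, positive functions `λ_{j,m}(h)` with classical expansions whose leading terms
are the (positive, increasingly ordered) eigenvalues of the iterated Schur complement blocks
`G_j` of `W₀ᵀW₀`, such that for `h ∈ (0, h₁]` the spectrum of `𝓜(h)`, with multiplicity,
consists of eigenvalues `μ_{j,m}(h)` with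
`|μ_{j,m}(h) − e^{−2 S j / h} λ_{j,m}(h)| ≤ e^{−(2 S j + c)/h}`. -/
theorem eigenvalues_of_graded_gram_matrix
    (p : ℕ) (hp : 1 ≤ p) (r : Fin p → ℕ) (hr : ∀ j, 1 ≤ r j)
    (S : Fin p → ℝ) (hSpos : ∀ j, 0 < S j) (hSmono : StrictMono S)
    (N : ℕ) (hN : Fintype.card (BlockIdx p r) ≤ N)
    (h₀ : ℝ) (hh₀ : 0 < h₀)
    (W : ℝ → Matrix (Fin N) (BlockIdx p r) ℝ)
    (Wk : ℕ → Matrix (Fin N) (BlockIdx p r) ℝ)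
    (hW : ∀ n : ℕ, ∃ C > (0 : ℝ), ∀ h ∈ Set.Ioc (0 : ℝ) h₀,
      ‖W h - ∑ k ∈ Finset.range (n + 1), h ^ k • Wk k‖ ≤ C * h ^ (n + 1))
    (hinj : Function.Injective (Wk 0).mulVec) :
    ∃ c > (0 : ℝ), ∃ h₁, 0 < h₁ ∧ h₁ ≤ h₀ ∧
      ∃ (lam : (j : Fin p) → Fin (r j) → ℝ → ℝ)
        (lam0 : (j : Fin p) → Fin (r j) → ℝ),
        (∀ j, Monotone (lam0 j)) ∧
        (∀ j m, 0 < lam0 j m) ∧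
        (∀ j : Fin p,
          (schurBlock p r ((Wk 0)ᵀ * Wk 0) (j : ℕ)).charpoly.roots =
            Multiset.map (fun m => lam0 j m) Finset.univ.val) ∧
        (∀ (j : Fin p) (m : Fin (r j)), ∀ h ∈ Set.Ioc (0 : ℝ) h₁, 0 < lam j m h) ∧
        (∀ (j : Fin p) (m : Fin (r j)), ∃ a : ℕ → ℝ, a 0 = lam0 j m ∧
          ∀ n : ℕ, ∃ C > (0 : ℝ), ∀ h ∈ Set.Ioc (0 : ℝ) h₁,
            |lam j m h - ∑ k ∈ Finset.range (n + 1), h ^ k * a k| ≤ C * h ^ (n + 1)) ∧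
        (∀ h ∈ Set.Ioc (0 : ℝ) h₁,
          ∃ μ : (j : Fin p) → Fin (r j) → ℝ,
            ((Matrix.diagonal (fun i : BlockIdx p r => Real.exp (-S i.1 / h)) * (W h)ᵀ *
                W h *
                Matrix.diagonal (fun i : BlockIdx p r => Real.exp (-S i.1 / h))).charpoly.roots =
              Multiset.map (fun i : BlockIdx p r => μ i.1 i.2) Finset.univ.val) ∧
            ∀ (j : Fin p) (m : Fin (r j)),
              |μ j m - Real.exp (-(2 * S j) / h) * lam j m h| ≤
                Real.exp (-(2 * S j + c) / h)) := by
  classical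
  let W' : ℝ → Matrix (Fin N) (BlockIdx p r) ℝ := fun h => if h = 0 then Wk 0 else W h
  have hW' : ∀ i j, HasExpansion fun h => W' h i j := fun i j n => by
    obtain ⟨C, hC, hCW⟩ := hW n
    refine ⟨∑ k ∈ Finset.range (n + 1), Polynomial.X ^ k * Polynomial.C (Wk k i j),
      IsBigO.trans (IsBigO.of_bound C ?_) (isBigO_pow_of_le n.le_succ nhdsWithin_le_nhds)⟩
    filter_upwards [Icc_mem_nhdsGE hh₀] with h hh
    rw [Real.norm_of_nonneg (pow_nonneg hh.1 _)]
    rcases hh.1.eq_or_lt with rfl | h0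
    · simp [W', Polynomial.eval_finsetSum, Finset.sum_range_succ']
    · have := (norm_entry_le_entrywise_sup_norm _ (i := i) (j := j)).trans (hCW h ⟨h0, hh.2⟩)
      simpa [W', h0.ne', Polynomial.eval_finsetSum, Matrix.sub_apply, Matrix.sum_apply,
        mul_comm (Wk _ _ _)]
        using this
  let A : ℝ → Matrix (BlockIdx p r) (BlockIdx p r) ℝ := fun h => (W' h)ᵀ * W' h
  have hA : ∀ i j, HasExpansion fun h => A h i j :=
    HasExpansion.matrix_mul (fun i j => hW' j i) hW'
  have hAs : ∀ h, (A h)ᵀ = A h := fun h => by simp [A]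
  have hA0 : A 0 = (Wk 0)ᵀ * Wk 0 := by simp [A, W']
  have hpd : (A 0).PosDef := by
    rw [hA0, ← conjTranspose_eq_transpose_of_trivial]
    exact PosDef.conjTranspose_mul_self _ hinj
  have hJ : ∀ (k : ℕ) (i j), HasExpansion fun h => schurBlock p r (A h) k i j := fun k i j =>
    .schurIter hA hpd k _ _
  choose V a hVa using fun (h : ℝ) (j : Fin p) =>
    exists_isSortedSpectrum (transpose_schurBlock (hAs h) j) (card_blkIdx p r j)
  have ha : ∀ j m, HasExpansion fun h => a h j m := fun j m =>
    .eigenvalue (card_blkIdx p r j) (hJ j) (fun h => transpose_schurBlock (hAs h) j)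
      (fun h => hVa h j) m
  have hpos : ∀ j m, 0 < a 0 j m := fun j m =>
    (hVa 0 j).pos (card_blkIdx p r j) (posDef_schurBlock hpd j) m
  obtain ⟨c, hc, hcS⟩ := exists_pos_le_sub_of_strictMono hSmono
  obtain ⟨Λ, hΛ, hΛa⟩ := HasExpansion.exists_bound fun i : BlockIdx p r => ha i.1 i.2
  obtain ⟨B, hB, hBL⟩ := HasExpansion.exists_bound
    (f := fun (i : Fin p × BlockIdx p r × BlockIdx p r) h =>
      (schurFactor p r (A h) i.1 * (schurFactor p r (A h) i.1)ᵀ) i.2.1 i.2.2)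
    fun i => .matrix_mul (fun _ _ => .schurFactor hA hpd _ _ _)
      (fun _ _ => .schurFactor hA hpd _ _ _) _ _
  have hev : ∀ᶠ h in 𝓝[>] (0 : ℝ), (∀ i : BlockIdx p r, |a h i.1 i.2| ≤ Λ) ∧
      (∀ i : Fin p × BlockIdx p r × BlockIdx p r,
        |(schurFactor p r (A h) i.1 * (schurFactor p r (A h) i.1)ᵀ) i.2.1 i.2.2| ≤ B) ∧
      (∀ i : BlockIdx p r, 0 < a h i.1 i.2) ∧
      (∀ k : Fin p, (schurBlock p r (A h) k).det ≠ 0) ∧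
      Fintype.card (BlockIdx p r) * p * B * Λ * Real.exp (-c / h) ≤ Real.exp (-(c / 2) / h) := by
    have hle : 𝓝[>] (0 : ℝ) ≤ 𝓝[≥] 0 := nhdsWithin_mono 0 Set.Ioi_subset_Ici_self
    refine (hΛa.filter_mono hle).and ((hBL.filter_mono hle).and ((eventually_all.2 fun i => ?_).and
      ((eventually_all.2 fun k => ?_).and (exists_rate_pos_of_exp _ hc))))
    · exact ((ha i.1 i.2).tendsto.eventually_const_lt (hpos _ _)).filter_mono hle
    · exact ((HasExpansion.det (hJ k)).tendsto.eventually_ne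
        (posDef_schurBlock hpd k).det_pos.ne').filter_mono hle
  obtain ⟨u, hu, hub⟩ := mem_nhdsGT_iff_exists_Ioc_subset.1 hev
  have hmem : ∀ h ∈ Set.Ioc 0 (min u h₀), h ∈ Set.Ioc 0 u := fun h hh =>
    ⟨hh.1, hh.2.trans (min_le_left _ _)⟩
  refine ⟨c / 2, half_pos hc, min u h₀, lt_min hu hh₀, min_le_right _ _,
    fun j m h => a h j m, fun j m => a 0 j m, fun j => (hVa 0 j).mono, hpos, fun j => ?_,
    fun j m h hh => (hub (hmem h hh)).2.2.1 ⟨j, m⟩,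
    fun j m => (ha j m).exists_coeff_Ioc fun h hh => (hub (hmem h hh)).1 ⟨j, m⟩, fun h hh => ?_⟩
  · rw [← hA0]
    exact (hVa 0 j).roots_charpoly (card_blkIdx p r j)
  · obtain ⟨h1, h2, -, h4, h5⟩ := hub (hmem h hh)
    have hdet : ∀ k : Fin p, IsUnit (schurBlock p r (A h) k).det := fun k => (h4 k).isUnit
    obtain ⟨μ, hμ, hμa⟩ := exists_roots_graded_charpoly (hAs h)
      (eq_sum_schurFactor (hAs h) hdet) (fun j i hi l => schurFactor_of_lt (A h) hi l)
      (fun j => schurFactor_of_eq (hdet j)) (hVa h) hSmono hcS hB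
      (fun j i i' => h2 (j, i, i')) hh.1
    refine ⟨μ, ?_, fun j m => (hμa j m).trans ?_⟩
    · simpa only [A, W', if_neg hh.1.ne', Matrix.mul_assoc] using hμ
    · rw [abs_mul, Real.abs_exp]
      have e : Real.exp (-(2 * S j + c / 2) / h) =
          Real.exp (-(c / 2) / h) * Real.exp (-(2 * S j) / h) := by
        rw [← Real.exp_add]; congr 1; ring
      rw [e]
      refine le_trans ?_ (mul_le_mul_of_nonneg_right h5 (Real.exp_pos _).le)
      have h6 : Fintype.card (BlockIdx p r) * (p * (B * Real.exp (-c / h))) *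
          Real.exp (-(2 * S j) / h) * |a h j m| ≤
          Fintype.card (BlockIdx p r) * (p * (B * Real.exp (-c / h))) *
          Real.exp (-(2 * S j) / h) * Λ :=
        mul_le_mul_of_nonneg_left (h1 ⟨j, m⟩) (by positivity)
      linarith
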